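/- arXiv:1706.02343 — 5 statements merged into one kernel-verified Lean document; each statement's English description precedes it below -/
import Mathlib

section
/- For every α with 0 < α < 1, the function f : [0,2] → ℝ defined by f(x) = x/(3 − x^α·(x − 1)) is operator monotone on [0,2] (the denominator is strictly positive on [0,2], so f is well defined). -/
open Matrix Set
open scoped ComplexOrder

/-- `f` is operator monotone on `I ⊆ ℝ`: for every `n ≥ 1` and all `n×n` Hermitian complex
matrices `A, B` with spectra (eigenvalues) contained in `I`, `A ≤ B` in the Loewner order
implies `f(A) ≤ f(B)`, where `f(A)` is given by the functional calculus. -/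
def OperatorMonotoneOn (f : ℝ → ℝ) (I : Set ℝ) : Prop :=
  ∀ (n : ℕ), 0 < n → ∀ (A B : Matrix (Fin n) (Fin n) ℂ)
    (hA : A.IsHermitian) (hB : B.IsHermitian),
    (∀ i, hA.eigenvalues i ∈ I) → (∀ i, hB.eigenvalues i ∈ I) →
    (B - A).PosSemidef → (hB.cfc f - hA.cfc f).PosSemidef

/-- `f` is operator convex on `I ⊆ ℝ`: for every `n ≥ 1`, every `t ∈ [0,1]` and all `n×n`
Hermitian complex matrices `A, B` with spectra contained in `I`,
`f(tA + (1−t)B) ≤ t·f(A) + (1−t)·f(B)` in the Loewner order. -/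
def OperatorConvexOn (f : ℝ → ℝ) (I : Set ℝ) : Prop :=
  ∀ (n : ℕ), 0 < n → ∀ t : ℝ, t ∈ Set.Icc (0 : ℝ) 1 →
  ∀ (A B : Matrix (Fin n) (Fin n) ℂ) (hA : A.IsHermitian) (hB : B.IsHermitian)
    (hAB : ((t : ℂ) • A + ((1 : ℂ) - (t : ℂ)) • B).IsHermitian),
    (∀ i, hA.eigenvalues i ∈ I) → (∀ i, hB.eigenvalues i ∈ I) →
    ((t : ℂ) • hA.cfc f + ((1 : ℂ) - (t : ℂ)) • hB.cfc f - hAB.cfc f).PosSemidef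

/-- `f` is strongly operator convex on `I ⊆ ℝ`: there is `x₀ ∈ I` such that for every `n ≥ 1`,
every `n×n` orthogonal projection `P` and every `n×n` Hermitian matrix `H` with spectrum
contained in `I`, `P·f(PHP + x₀(1−P))·P ≤ f(H)` in the Loewner order. -/
def StronglyOperatorConvexOn (f : ℝ → ℝ) (I : Set ℝ) : Prop :=
  ∃ x₀ ∈ I, ∀ (n : ℕ), 0 < n → ∀ (P H : Matrix (Fin n) (Fin n) ℂ),
    P.IsHermitian → P * P = P →
    ∀ (hH : H.IsHermitian)
      (hK : (P * H * P + (x₀ : ℂ) • ((1 : Matrix (Fin n) (Fin n) ℂ) - P)).IsHermitian),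
    (∀ i, hH.eigenvalues i ∈ I) →
    (hH.cfc f - P * hK.cfc f * P).PosSemidef

open Filter Topology

section CStarAlgebra

variable {A : Type*} [CStarAlgebra A] [PartialOrder A] [StarOrderedRing A] {a b : A}

/-- Inversion reverses inequalities between continuous functional calculi of positive
functions. -/
lemma cfc_inv_le_cfc_inv {f : ℝ → ℝ} (ha : IsSelfAdjoint a) (hb : IsSelfAdjoint b)
    (hfa : ContinuousOn f (spectrum ℝ a)) (hfb : ContinuousOn f (spectrum ℝ b))
    (hpa : ∀ x ∈ spectrum ℝ a, 0 < f x) (hpb : ∀ x ∈ spectrum ℝ b, 0 < f x)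
    (h : cfc f a ≤ cfc f b) :
    cfc (fun x => (f x)⁻¹) b ≤ cfc (fun x => (f x)⁻¹) a := by
  have key : ∀ c : A, IsSelfAdjoint c → ContinuousOn f (spectrum ℝ c) →
      (∀ x ∈ spectrum ℝ c, 0 < f x) →
      IsStrictlyPositive (cfc f c) ∧ cfc f c ^ (-1 : ℝ) = cfc (fun x => (f x)⁻¹) c := by
    intro c hc hf hp
    have hpos : IsStrictlyPositive (cfc f c) := (cfc_isStrictlyPositive_iff f c).2 hp
    refine ⟨hpos, ?_⟩
    have hpow : ContinuousOn (fun x : ℝ => x ^ (-1 : ℝ)) (f '' spectrum ℝ c) := by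
      rintro _ ⟨x, hx, rfl⟩
      exact (Real.continuousAt_rpow_const _ _ (.inl (hp x hx).ne')).continuousWithinAt
    rw [CFC.rpow_eq_cfc_real hpos.nonneg, ← cfc_comp' (fun x : ℝ => x ^ (-1 : ℝ)) f c hpow]
    exact cfc_congr fun x _ => Real.rpow_neg_one _
  rw [← (key a ha hfa hpa).2, ← (key b hb hfb hpb).2]
  exact CStarAlgebra.rpow_neg_one_le_rpow_neg_one h (key a ha hfa hpa).1

/-- `x ↦ x ^ p` is operator monotone for `p ∈ [0, 1]`. -/
lemma cfc_rpow_le_cfc_rpow {p : ℝ} (hp : p ∈ Icc 0 1) (ha : 0 ≤ a) (hab : a ≤ b) :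
    cfc (fun x : ℝ => x ^ p) a ≤ cfc (fun x : ℝ => x ^ p) b := by
  rw [← CFC.rpow_eq_cfc_real ha, ← CFC.rpow_eq_cfc_real (ha.trans hab)]
  exact CFC.rpow_le_rpow hp hab

/-- `x ↦ 3 * x⁻¹ - x ^ α + (x ^ (1 - α))⁻¹` is operator antitone on `(0, ∞)`. -/
lemma cfc_three_mul_inv_sub_rpow_add_le {α : ℝ} (hα0 : 0 < α) (hα1 : α < 1)
    (ha : IsSelfAdjoint a) (hb : IsSelfAdjoint b)
    (hpa : ∀ x ∈ spectrum ℝ a, 0 < x) (hpb : ∀ x ∈ spectrum ℝ b, 0 < x) (hab : a ≤ b) :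
    cfc (fun x : ℝ => 3 * x⁻¹ - x ^ α + (x ^ (1 - α))⁻¹) b ≤
      cfc (fun x : ℝ => 3 * x⁻¹ - x ^ α + (x ^ (1 - α))⁻¹) a := by
  have ha0 : 0 ≤ a := (StarOrderedRing.nonneg_iff_spectrum_nonneg a).2 fun x hx => (hpa x hx).le
  have cpow : ∀ (p : ℝ) (c : A), (∀ x ∈ spectrum ℝ c, 0 < x) →
      ContinuousOn (fun x : ℝ => x ^ p) (spectrum ℝ c) := fun p c hc x hx =>
    (Real.continuousAt_rpow_const _ _ (.inl (hc x hx).ne')).continuousWithinAt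
  have cpowinv : ∀ (p : ℝ) (c : A), (∀ x ∈ spectrum ℝ c, 0 < x) →
      ContinuousOn (fun x : ℝ => (x ^ p)⁻¹) (spectrum ℝ c) := fun p c hc =>
    (cpow p c hc).inv₀ fun x hx => (Real.rpow_pos_of_pos (hc x hx) p).ne'
  have cinv : ∀ c : A, (∀ x ∈ spectrum ℝ c, 0 < x) →
      ContinuousOn (fun x : ℝ => x⁻¹) (spectrum ℝ c) := fun c hc =>
    continuousOn_id.inv₀ fun x hx => (hc x hx).ne'
  have split : ∀ c : A, IsSelfAdjoint c → (∀ x ∈ spectrum ℝ c, 0 < x) →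
      cfc (fun x : ℝ => 3 * x⁻¹ - x ^ α + (x ^ (1 - α))⁻¹) c =
        (3 : ℝ) • cfc (fun x : ℝ => x⁻¹) c - cfc (fun x : ℝ => x ^ α) c +
          cfc (fun x : ℝ => (x ^ (1 - α))⁻¹) c := by
    intro c hc hp
    have h3 : ContinuousOn (fun x : ℝ => 3 * x⁻¹) (spectrum ℝ c) := (cinv c hp).const_mul 3
    rw [cfc_add c (fun x : ℝ => 3 * x⁻¹ - x ^ α) (fun x => (x ^ (1 - α))⁻¹)
        (h3.sub (cpow α c hp)) (cpowinv _ c hp),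
      cfc_sub (fun x : ℝ => 3 * x⁻¹) (fun x => x ^ α) c h3 (cpow α c hp),
      cfc_const_mul (3 : ℝ) (fun x => x⁻¹) c (cinv c hp)]
  have hinv : cfc (fun x : ℝ => x⁻¹) b ≤ cfc (fun x : ℝ => x⁻¹) a :=
    cfc_inv_le_cfc_inv (f := fun x => x) ha hb continuousOn_id continuousOn_id hpa hpb
      (by rwa [cfc_id' ℝ a, cfc_id' ℝ b])
  have hpow := cfc_rpow_le_cfc_rpow ⟨hα0.le, hα1.le⟩ ha0 hab
  have hpowinv := cfc_inv_le_cfc_inv ha hb (cpow (1 - α) a hpa) (cpow (1 - α) b hpb)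
    (fun x hx => Real.rpow_pos_of_pos (hpa x hx) _)
    (fun x hx => Real.rpow_pos_of_pos (hpb x hx) _)
    (cfc_rpow_le_cfc_rpow (p := 1 - α) ⟨by linarith, by linarith⟩ ha0 hab)
  rw [split a ha hpa, split b hb hpb]
  exact add_le_add (sub_le_sub (smul_le_smul_of_nonneg_left hinv (by norm_num)) hpow) hpowinv

end CStarAlgebra

lemma three_sub_rpow_mul_pos {α : ℝ} (hα0 : 0 < α) (hα1 : α < 1) {x : ℝ} (hx : x ∈ Icc (0 : ℝ) 2) :
    0 < 3 - x ^ α * (x - 1) := by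
  have h0 : 0 ≤ x ^ α := Real.rpow_nonneg hx.1 α
  have h2 : x ^ α ≤ 2 := by
    calc x ^ α ≤ 2 ^ α := Real.rpow_le_rpow hx.1 hx.2 hα0.le
      _ ≤ 2 ^ (1 : ℝ) := Real.rpow_le_rpow_of_exponent_le (by norm_num) hα1.le
      _ = 2 := Real.rpow_one 2
  nlinarith [hx.1, hx.2]

lemma three_mul_inv_sub_rpow_add_eq (α : ℝ) {x : ℝ} (hx : 0 < x) :
    3 * x⁻¹ - x ^ α + (x ^ (1 - α))⁻¹ = (3 - x ^ α * (x - 1)) / x := by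
  have : 0 < x ^ α := Real.rpow_pos_of_pos hx α
  rw [Real.rpow_sub hx, Real.rpow_one]
  field_simp
  ring

/-- Operator monotonicity on `(0, 2]` in a C⋆-algebra. -/
lemma cfc_div_three_sub_le {A : Type*} [CStarAlgebra A] [PartialOrder A] [StarOrderedRing A]
    {a b : A} {α : ℝ} (hα0 : 0 < α) (hα1 : α < 1)
    (ha : IsSelfAdjoint a) (hb : IsSelfAdjoint b)
    (hpa : ∀ x ∈ spectrum ℝ a, x ∈ Ioc (0 : ℝ) 2) (hpb : ∀ x ∈ spectrum ℝ b, x ∈ Ioc (0 : ℝ) 2)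
    (hab : a ≤ b) :
    cfc (fun x : ℝ => x / (3 - x ^ α * (x - 1))) a ≤
      cfc (fun x : ℝ => x / (3 - x ^ α * (x - 1))) b := by
  have hpos : ∀ x ∈ Ioc (0 : ℝ) 2, 0 < 3 * x⁻¹ - x ^ α + (x ^ (1 - α))⁻¹ := fun x hx => by
    rw [three_mul_inv_sub_rpow_add_eq α hx.1]
    exact div_pos (three_sub_rpow_mul_pos hα0 hα1 (Ioc_subset_Icc_self hx)) hx.1
  have hcont : ContinuousOn (fun x : ℝ => 3 * x⁻¹ - x ^ α + (x ^ (1 - α))⁻¹) (Ioc 0 2) := by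
    intro x hx
    have h1 := Real.continuousAt_rpow_const x α (.inl hx.1.ne')
    have h2 := (Real.continuousAt_rpow_const x (1 - α) (.inl hx.1.ne')).inv₀
      (Real.rpow_pos_of_pos hx.1 _).ne'
    exact ((((continuousAt_inv₀ hx.1.ne').const_mul 3).sub h1).add h2).continuousWithinAt
  have hcongr : ∀ c : A, (∀ x ∈ spectrum ℝ c, x ∈ Ioc (0 : ℝ) 2) →
      cfc (fun x : ℝ => x / (3 - x ^ α * (x - 1))) c =
        cfc (fun x : ℝ => (3 * x⁻¹ - x ^ α + (x ^ (1 - α))⁻¹)⁻¹) c := fun c hc =>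
    cfc_congr fun x hx => by
      simp only [three_mul_inv_sub_rpow_add_eq α (hc x hx).1, inv_div]
  rw [hcongr a hpa, hcongr b hpb]
  exact cfc_inv_le_cfc_inv hb ha (hcont.mono hpb) (hcont.mono hpa)
    (fun x hx => hpos x (hpb x hx)) (fun x hx => hpos x (hpa x hx))
    (cfc_three_mul_inv_sub_rpow_add_le hα0 hα1 ha hb (fun x hx => (hpa x hx).1)
      (fun x hx => (hpb x hx).1) hab)

lemma continuousOn_div_three_sub {α : ℝ} (hα0 : 0 < α) (hα1 : α < 1) :
    ContinuousOn (fun x : ℝ => x / (3 - x ^ α * (x - 1))) (Icc 0 2) := by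
  refine continuousOn_id.div ?_ fun x hx => (three_sub_rpow_mul_pos hα0 hα1 hx).ne'
  have := Real.continuous_rpow_const hα0.le
  exact (continuous_const.sub (this.mul (continuous_id.sub continuous_const))).continuousOn

/-- For `0 < t < 1`, the map `x ↦ (1 - t) * x + t` sends `[0, 2]` into `(0, 2]`. -/
lemma one_sub_mul_add_mem_Ioc {t x : ℝ} (ht : t ∈ Ioo (0 : ℝ) 1) (hx : x ∈ Icc (0 : ℝ) 2) :
    (1 - t) * x + t ∈ Ioc (0 : ℝ) 2 := by
  constructor <;> nlinarith [hx.1, hx.2, ht.1, ht.2]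

/-- A continuous function which is operator monotone on `(0, 2]` becomes operator monotone on
`[0, 2]` after precomposition with `x ↦ (1 - t) * x + t`, for `0 < t < 1`. -/
lemma cfc_comp_one_sub_mul_add_le {A : Type*} [CStarAlgebra A] [PartialOrder A]
    [StarOrderedRing A] {f : ℝ → ℝ} (hf : ContinuousOn f (Icc 0 2))
    (h : ∀ a b : A, IsSelfAdjoint a → IsSelfAdjoint b →
      (∀ x ∈ spectrum ℝ a, x ∈ Ioc (0 : ℝ) 2) → (∀ x ∈ spectrum ℝ b, x ∈ Ioc (0 : ℝ) 2) →
      a ≤ b → cfc f a ≤ cfc f b)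
    {a b : A} (ha : IsSelfAdjoint a) (hb : IsSelfAdjoint b)
    (hsa : ∀ x ∈ spectrum ℝ a, x ∈ Icc (0 : ℝ) 2) (hsb : ∀ x ∈ spectrum ℝ b, x ∈ Icc (0 : ℝ) 2)
    (hab : a ≤ b) {t : ℝ} (ht : t ∈ Ioo (0 : ℝ) 1) :
    cfc (fun x => f ((1 - t) * x + t)) a ≤ cfc (fun x => f ((1 - t) * x + t)) b := by
  have hspec : ∀ c : A, IsSelfAdjoint c → (∀ x ∈ spectrum ℝ c, x ∈ Icc (0 : ℝ) 2) →
      ∀ x ∈ spectrum ℝ (cfc (fun x : ℝ => (1 - t) * x + t) c), x ∈ Ioc (0 : ℝ) 2 := by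
    intro c hc hs x hx
    rw [cfc_map_spectrum (fun x : ℝ => (1 - t) * x + t) c hc] at hx
    obtain ⟨y, hy, rfl⟩ := hx
    exact one_sub_mul_add_mem_Ioc ht (hs y hy)
  have hcomp : ∀ c : A, IsSelfAdjoint c → (∀ x ∈ spectrum ℝ c, x ∈ Icc (0 : ℝ) 2) →
      cfc (fun x => f ((1 - t) * x + t)) c = cfc f (cfc (fun x : ℝ => (1 - t) * x + t) c) := by
    intro c hc hs
    refine cfc_comp' f (fun x : ℝ => (1 - t) * x + t) c (hf.mono ?_)
    rintro _ ⟨y, hy, rfl⟩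
    exact Ioc_subset_Icc_self (one_sub_mul_add_mem_Ioc ht (hs y hy))
  have haffine : ∀ c : A, IsSelfAdjoint c →
      cfc (fun x : ℝ => (1 - t) * x + t) c = (1 - t) • c + algebraMap ℝ A t := by
    intro c hc
    rw [cfc_add_const t (fun x => (1 - t) * x) c, cfc_const_mul_id (1 - t) c]
  rw [hcomp a ha hsa, hcomp b hb hsb]
  refine h _ _ (cfc_predicate _ _) (cfc_predicate _ _) (hspec a ha hsa) (hspec b hb hsb) ?_
  rw [haffine a ha, haffine b hb]
  gcongr
  linarith [ht.2]

/-- The functional calculus of a Hermitian matrix depends continuously on the function. -/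
lemma Matrix.IsHermitian.tendsto_cfc {n ι : Type*} [Fintype n] [DecidableEq n]
    {A : Matrix n n ℂ} (hA : A.IsHermitian) {l : Filter ι} {F : ι → ℝ → ℝ} {f : ℝ → ℝ}
    (h : ∀ i, Tendsto (fun t => F t (hA.eigenvalues i)) l (𝓝 (f (hA.eigenvalues i)))) :
    Tendsto (fun t => hA.cfc (F t)) l (𝓝 (hA.cfc f)) := by
  have hd : Tendsto (fun t => diagonal (fun i => ((F t (hA.eigenvalues i) : ℝ) : ℂ))) l
      (𝓝 (diagonal fun i => ((f (hA.eigenvalues i) : ℝ) : ℂ))) := by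
    refine ((continuous_id.matrix_diagonal).tendsto _).comp (tendsto_pi_nhds.2 fun i => ?_)
    exact (Complex.continuous_ofReal.tendsto _).comp (h i)
  simp only [Matrix.IsHermitian.cfc, Unitary.conjStarAlgAut_apply]
  exact (hd.const_mul _).mul_const _

open scoped MatrixOrder Matrix.Norms.L2Operator in
/-- A continuous function on `[0, 2]` which is operator monotone on `(0, 2]` is operator monotone
on `[0, 2]`. -/
lemma operatorMonotoneOn_Icc_of_Ioc {f : ℝ → ℝ} (hf : ContinuousOn f (Icc 0 2))
    (h : ∀ (n : ℕ) (A B : Matrix (Fin n) (Fin n) ℂ), IsSelfAdjoint A → IsSelfAdjoint B →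
      (∀ x ∈ spectrum ℝ A, x ∈ Ioc (0 : ℝ) 2) → (∀ x ∈ spectrum ℝ B, x ∈ Ioc (0 : ℝ) 2) →
      A ≤ B → cfc f A ≤ cfc f B) :
    OperatorMonotoneOn f (Icc 0 2) := by
  intro n _ A B hA hB hsA hsB hAB
  have hspec : ∀ (C : Matrix (Fin n) (Fin n) ℂ) (hC : C.IsHermitian),
      (∀ i, hC.eigenvalues i ∈ Icc (0 : ℝ) 2) → ∀ x ∈ spectrum ℝ C, x ∈ Icc (0 : ℝ) 2 := by
    intro C hC hs x hx
    rw [hC.spectrum_real_eq_range_eigenvalues] at hx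
    obtain ⟨i, rfl⟩ := hx
    exact hs i
  have hlim : ∀ (C : Matrix (Fin n) (Fin n) ℂ) (hC : C.IsHermitian),
      (∀ i, hC.eigenvalues i ∈ Icc (0 : ℝ) 2) →
      Tendsto (fun t : ℝ => hC.cfc (fun x => f ((1 - t) * x + t))) (𝓝[>] 0) (𝓝 (hC.cfc f)) := by
    intro C hC hs
    refine hC.tendsto_cfc fun i => (hf _ (hs i)).tendsto.comp ?_
    refine tendsto_nhdsWithin_iff.2 ⟨?_, ?_⟩
    · have : Continuous fun t : ℝ => (1 - t) * hC.eigenvalues i + t := by fun_prop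
      simpa using (this.tendsto 0).mono_left nhdsWithin_le_nhds
    · filter_upwards [Ioo_mem_nhdsGT one_pos] with t ht
      exact Ioc_subset_Icc_self (one_sub_mul_add_mem_Ioc ht (hs i))
  refine Matrix.le_iff.1 (le_of_tendsto_of_tendsto (hlim A hA hsA) (hlim B hB hsB) ?_)
  filter_upwards [Ioo_mem_nhdsGT one_pos] with t ht
  rw [← hA.cfc_eq, ← hB.cfc_eq]
  exact cfc_comp_one_sub_mul_add_le hf (h n) hA hB (hspec A hA hsA) (hspec B hB hsB)
    (Matrix.le_iff.2 hAB) ht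

open scoped MatrixOrder Matrix.Norms.L2Operator in
lemma operatorMonotoneOn_div_three_sub {α : ℝ} (hα0 : 0 < α) (hα1 : α < 1) :
    OperatorMonotoneOn (fun x => x / (3 - x ^ α * (x - 1))) (Icc (0 : ℝ) 2) :=
  operatorMonotoneOn_Icc_of_Ioc (continuousOn_div_three_sub hα0 hα1)
    fun _ _ _ hA hB hsA hsB hAB => cfc_div_three_sub_le hα0 hα1 hA hB hsA hsB hAB

/-- for `0 < α < 1`, the function `x ↦ x/(3 − x^α·(x − 1))` is well defined
(the denominator is strictly positive on `[0,2]`) and operator monotone on `[0,2]`. -/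
theorem stmt14 (α : ℝ) (hα0 : 0 < α) (hα1 : α < 1) :
    (∀ x ∈ Set.Icc (0 : ℝ) 2, 0 < 3 - x ^ α * (x - 1)) ∧
    OperatorMonotoneOn (fun x => x / (3 - x ^ α * (x - 1))) (Set.Icc (0 : ℝ) 2) :=
  ⟨fun _ hx => three_sub_rpow_mul_pos hα0 hα1 hx, operatorMonotoneOn_div_three_sub hα0 hα1⟩
end

section
/- For every α with 0 < α < 1, the function f : [0,2] → ℝ defined by f(x) = x/(3 − (x − 1)·(x^α − (2 − x)^α)) is operator monotone on [0,2] (the denominator is strictly positive on [0,2], so f is well defined). -/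
open Matrix Set
open scoped ComplexOrder

open Filter Topology MeasureTheory

namespace Matrix.IsHermitian

variable {n : Type*} [Fintype n] [DecidableEq n] {A B : Matrix n n ℂ}

/-- The real quadratic form `v ↦ ⟨v, f(A) v⟩`, written in an eigenbasis of `A`. -/
noncomputable def cfcForm (hA : A.IsHermitian) (f : ℝ → ℝ) (v : n → ℂ) : ℝ :=
  ∑ i, f (hA.eigenvalues i) *
    Complex.normSq ((star (hA.eigenvectorUnitary : Matrix n n ℂ) *ᵥ v) i)

lemma isHermitian_cfc (hA : A.IsHermitian) (f : ℝ → ℝ) : (hA.cfc f).IsHermitian := by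
  rw [← hA.cfc_eq]
  exact cfc_predicate f A

lemma star_dotProduct_cfc_mulVec (hA : A.IsHermitian) (f : ℝ → ℝ) (v : n → ℂ) :
    star v ⬝ᵥ (hA.cfc f *ᵥ v) = (hA.cfcForm f v : ℂ) := by
  rw [IsHermitian.cfc, Unitary.conjStarAlgAut_apply, ← mulVec_mulVec, ← mulVec_mulVec,
    dotProduct_mulVec, ← star_star (hA.eigenvectorUnitary : Matrix n n ℂ), star_eq_conjTranspose,
    star_eq_conjTranspose, ← star_mulVec]
  simp only [cfcForm, dotProduct, mulVec_diagonal, Complex.ofReal_sum, Complex.ofReal_mul,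
    ← Complex.mul_conj, star_eq_conjTranspose, conjTranspose_conjTranspose]
  refine Finset.sum_congr rfl fun i _ ↦ ?_
  simp only [Pi.star_apply, Function.comp_apply, RCLike.star_def]
  rw [mul_comm, mul_assoc]
  rfl

lemma posSemidef_cfc_sub_cfc_iff (hA : A.IsHermitian) (hB : B.IsHermitian) (f : ℝ → ℝ) :
    (hB.cfc f - hA.cfc f).PosSemidef ↔ ∀ v, hA.cfcForm f v ≤ hB.cfcForm f v := by
  rw [posSemidef_iff_dotProduct_mulVec,
    and_iff_right ((hB.isHermitian_cfc f).sub (hA.isHermitian_cfc f))]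
  refine forall_congr' fun v ↦ ?_
  rw [sub_mulVec, dotProduct_sub, star_dotProduct_cfc_mulVec, star_dotProduct_cfc_mulVec,
    sub_nonneg, Complex.real_le_real]

lemma continuousOn_spectrum (hA : A.IsHermitian) (f : ℝ → ℝ) : ContinuousOn f (spectrum ℝ A) := by
  rw [hA.spectrum_real_eq_range_eigenvalues]
  exact (Set.finite_range _).continuousOn f

lemma cfc_id' (hA : A.IsHermitian) : hA.cfc (fun x ↦ x) = A := by
  rw [← hA.cfc_eq]
  exact _root_.cfc_id' ℝ A hA

lemma cfc_cfc (hA : A.IsHermitian) (f g : ℝ → ℝ) :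
    (hA.isHermitian_cfc g).cfc f = hA.cfc (f ∘ g) := by
  rw [← cfc_eq, ← hA.cfc_eq, ← hA.cfc_eq]
  refine (cfc_comp f g A hA ?_ (hA.continuousOn_spectrum g)).symm
  rw [hA.spectrum_real_eq_range_eigenvalues]
  exact ((Set.finite_range _).image g).continuousOn f

lemma eigenvalues_cfc_mem (hA : A.IsHermitian) {g : ℝ → ℝ} {I J : Set ℝ} (hg : MapsTo g I J)
    (h : ∀ i, hA.eigenvalues i ∈ I) (i : n) : (hA.isHermitian_cfc g).eigenvalues i ∈ J := by
  have hi : (hA.isHermitian_cfc g).eigenvalues i ∈ spectrum ℝ (cfc g A) := by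
    rw [hA.cfc_eq]
    exact (hA.isHermitian_cfc g).eigenvalues_mem_spectrum_real i
  rw [cfc_map_spectrum g A hA.isSelfAdjoint (hA.continuousOn_spectrum g),
    hA.spectrum_real_eq_range_eigenvalues] at hi
  obtain ⟨_, ⟨j, rfl⟩, hj⟩ := hi
  rw [← hj]
  exact hg (h j)

lemma cfc_fun_neg (hA : A.IsHermitian) (f : ℝ → ℝ) : hA.cfc (fun x ↦ -f x) = -hA.cfc f := by
  rw [← hA.cfc_eq, ← hA.cfc_eq, cfc_neg]

lemma cfc_mul_cfc_inv (hA : A.IsHermitian) {f : ℝ → ℝ} (hf : ∀ i, f (hA.eigenvalues i) ≠ 0) :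
    hA.cfc f * hA.cfc (fun x ↦ (f x)⁻¹) = 1 := by
  rw [← hA.cfc_eq, ← hA.cfc_eq, ← cfc_mul _ _ A (hA.continuousOn_spectrum _)
    (hA.continuousOn_spectrum _), ← cfc_one ℝ A hA]
  refine cfc_congr fun x hx ↦ ?_
  rw [hA.spectrum_real_eq_range_eigenvalues] at hx
  obtain ⟨i, rfl⟩ := hx
  simp [hf i]

lemma posDef_cfc (hA : A.IsHermitian) {f : ℝ → ℝ} (hf : ∀ i, 0 < f (hA.eigenvalues i)) :
    (hA.cfc f).PosDef := by
  have hpos : (hA.cfc f).PosSemidef := by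
    refine .of_dotProduct_mulVec_nonneg (hA.isHermitian_cfc f) fun v ↦ ?_
    rw [star_dotProduct_cfc_mulVec, Complex.zero_le_real]
    exact Finset.sum_nonneg fun i _ ↦ mul_nonneg (hf i).le (Complex.normSq_nonneg _)
  exact hpos.posDef_iff_isUnit.mpr (.of_mul_eq_one _ (hA.cfc_mul_cfc_inv fun i ↦ (hf i).ne'))

lemma posSemidef_cfc_inv_sub_cfc_inv (hA : A.IsHermitian) (hB : B.IsHermitian) {f : ℝ → ℝ}
    (hfA : ∀ i, 0 < f (hA.eigenvalues i)) (hfB : ∀ i, 0 < f (hB.eigenvalues i))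
    (h : (hB.cfc f - hA.cfc f).PosSemidef) :
    (hA.cfc (fun x ↦ (f x)⁻¹) - hB.cfc (fun x ↦ (f x)⁻¹)).PosSemidef := by
  have hP := hB.posDef_cfc hfB
  have hQ := hA.posDef_cfc hfA
  have := hP.isUnit.invertible
  have := hQ.inv.isUnit.invertible
  rw [← inv_eq_right_inv (hA.cfc_mul_cfc_inv fun i ↦ (hfA i).ne'),
    ← inv_eq_right_inv (hB.cfc_mul_cfc_inv fun i ↦ (hfB i).ne')]
  have hb : (Matrix.fromBlocks (hB.cfc f) 1 1ᴴ (hA.cfc f)⁻¹).PosSemidef := by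
    have := hQ.isUnit.invertible
    rw [PosDef.fromBlocks₂₂ _ 1 hQ.inv]
    simpa using h
  simpa using (PosDef.fromBlocks₁₁ 1 _ hP).mp hb

end Matrix.IsHermitian

namespace OperatorMonotoneOn

variable {f g : ℝ → ℝ} {I J : Set ℝ}

lemma congr (hf : OperatorMonotoneOn f I) (h : EqOn f g I) : OperatorMonotoneOn g I := by
  intro n hn A B hA hB hAI hBI hAB
  have key : ∀ {C : Matrix (Fin n) (Fin n) ℂ} (hC : C.IsHermitian),
      (∀ i, hC.eigenvalues i ∈ I) → hC.cfc g = hC.cfc f := fun hC hCI ↦ by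
    have : f ∘ hC.eigenvalues = g ∘ hC.eigenvalues := funext fun i ↦ h (hCI i)
    simp only [IsHermitian.cfc, this]
  rw [key hA hAI, key hB hBI]
  exact hf n hn A B hA hB hAI hBI hAB

protected lemma id (I : Set ℝ) : OperatorMonotoneOn (fun x ↦ x) I := by
  intro n _ A B hA hB _ _ hAB
  rwa [hA.cfc_id', hB.cfc_id']

protected lemma const (c : ℝ) (I : Set ℝ) : OperatorMonotoneOn (fun _ ↦ c) I := by
  intro n _ A B hA hB _ _ _
  rw [← hA.cfc_eq, ← hB.cfc_eq, cfc_const c A hA.isSelfAdjoint, cfc_const c B hB.isSelfAdjoint, sub_self]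
  exact .zero

lemma add (hf : OperatorMonotoneOn f I) (hg : OperatorMonotoneOn g I) :
    OperatorMonotoneOn (fun x ↦ f x + g x) I := by
  intro n hn A B hA hB hAI hBI hAB
  have h₁ := (hA.posSemidef_cfc_sub_cfc_iff hB f).mp (hf n hn A B hA hB hAI hBI hAB)
  have h₂ := (hA.posSemidef_cfc_sub_cfc_iff hB g).mp (hg n hn A B hA hB hAI hBI hAB)
  refine (hA.posSemidef_cfc_sub_cfc_iff hB _).mpr fun v ↦ ?_
  simpa only [IsHermitian.cfcForm, add_mul, Finset.sum_add_distrib] using add_le_add (h₁ v) (h₂ v)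

lemma const_mul {c : ℝ} (hc : 0 ≤ c) (hf : OperatorMonotoneOn f I) :
    OperatorMonotoneOn (fun x ↦ c * f x) I := by
  intro n hn A B hA hB hAI hBI hAB
  have h := (hA.posSemidef_cfc_sub_cfc_iff hB f).mp (hf n hn A B hA hB hAI hBI hAB)
  refine (hA.posSemidef_cfc_sub_cfc_iff hB _).mpr fun v ↦ ?_
  simpa only [IsHermitian.cfcForm, mul_assoc, ← Finset.mul_sum] using
    mul_le_mul_of_nonneg_left (h v) hc

lemma comp (hf : OperatorMonotoneOn f J) (hg : OperatorMonotoneOn g I) (h : MapsTo g I J) :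
    OperatorMonotoneOn (f ∘ g) I := by
  intro n hn A B hA hB hAI hBI hAB
  rw [← hA.cfc_cfc, ← hB.cfc_cfc]
  exact hf n hn _ _ _ _ (hA.eigenvalues_cfc_mem h hAI) (hB.eigenvalues_cfc_mem h hBI)
    (hg n hn A B hA hB hAI hBI hAB)

lemma neg_inv_of_pos (hf : OperatorMonotoneOn f I) (h : ∀ x ∈ I, 0 < f x) :
    OperatorMonotoneOn (fun x ↦ -(f x)⁻¹) I := by
  intro n hn A B hA hB hAI hBI hAB
  rw [hA.cfc_fun_neg, hB.cfc_fun_neg, neg_sub_neg]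
  exact hA.posSemidef_cfc_inv_sub_cfc_inv hB (fun i ↦ h _ (hAI i)) (fun i ↦ h _ (hBI i))
    (hf n hn A B hA hB hAI hBI hAB)

lemma inv_of_antitone (hf : OperatorMonotoneOn (fun x ↦ -f x) I) (h : ∀ x ∈ I, 0 < f x) :
    OperatorMonotoneOn (fun x ↦ (f x)⁻¹) I := by
  intro n hn A B hA hB hAI hBI hAB
  refine hB.posSemidef_cfc_inv_sub_cfc_inv hA (fun i ↦ h _ (hBI i)) (fun i ↦ h _ (hAI i)) ?_
  simpa only [hA.cfc_fun_neg, hB.cfc_fun_neg, neg_sub_neg] using hf n hn A B hA hB hAI hBI hAB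

lemma of_tendsto {ι : Type*} {l : Filter ι} [l.NeBot] {F : ι → ℝ → ℝ}
    (hF : ∀ᶠ k in l, OperatorMonotoneOn (F k) I)
    (h : ∀ x ∈ I, Tendsto (fun k ↦ F k x) l (𝓝 (f x))) : OperatorMonotoneOn f I := by
  intro n hn A B hA hB hAI hBI hAB
  refine (hA.posSemidef_cfc_sub_cfc_iff hB _).mpr fun v ↦ ?_
  refine le_of_tendsto_of_tendsto (tendsto_finsetSum _ fun i _ ↦ (h _ (hAI i)).mul_const _)
    (tendsto_finsetSum _ fun i _ ↦ (h _ (hBI i)).mul_const _) ?_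
  filter_upwards [hF] with k hk
  exact (hA.posSemidef_cfc_sub_cfc_iff hB _).mp (hk n hn A B hA hB hAI hBI hAB) v

lemma integral {ι : Type*} [MeasurableSpace ι] {μ : Measure ι} {k : ι → ℝ → ℝ}
    (hk : ∀ᵐ s ∂μ, OperatorMonotoneOn (k s) I) (hint : ∀ x ∈ I, Integrable (fun s ↦ k s x) μ) :
    OperatorMonotoneOn (fun x ↦ ∫ s, k s x ∂μ) I := by
  intro n hn A B hA hB hAI hBI hAB
  have form_eq : ∀ {C : Matrix (Fin n) (Fin n) ℂ} (hC : C.IsHermitian) (v : Fin n → ℂ),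
      (∀ i, hC.eigenvalues i ∈ I) → Integrable (fun s ↦ hC.cfcForm (k s) v) μ ∧
      hC.cfcForm (fun x ↦ ∫ s, k s x ∂μ) v = ∫ s, hC.cfcForm (k s) v ∂μ := fun hC v hCI ↦ by
    have hi := fun i ↦ (hint _ (hCI i)).mul_const
      (Complex.normSq ((star (hC.eigenvectorUnitary : Matrix (Fin n) (Fin n) ℂ) *ᵥ v) i))
    refine ⟨integrable_finsetSum _ fun i _ ↦ hi i, ?_⟩
    simp only [IsHermitian.cfcForm]
    rw [integral_finsetSum _ fun i _ ↦ hi i]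
    simp only [integral_mul_const]
  refine (hA.posSemidef_cfc_sub_cfc_iff hB _).mpr fun v ↦ ?_
  rw [(form_eq hA v hAI).2, (form_eq hB v hBI).2]
  refine integral_mono_ae (form_eq hA v hAI).1 (form_eq hB v hBI).1 ?_
  filter_upwards [hk] with s hs
  exact (hA.posSemidef_cfc_sub_cfc_iff hB _).mp (hs n hn A B hA hB hAI hBI hAB) v

lemma Icc_of_Ioo {a b : ℝ} (hab : a < b) (hf : OperatorMonotoneOn f (Ioo a b))
    (hc : ContinuousOn f (Icc a b)) : OperatorMonotoneOn f (Icc a b) := by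
  let g : ℝ → ℝ → ℝ := fun ε x ↦ (1 - ε) * x + ε * ((a + b) / 2)
  have hε : ∀ᶠ ε in 𝓝[>] (0 : ℝ), ε ∈ Ioo (0 : ℝ) 1 := Ioo_mem_nhdsGT one_pos
  have hmaps : ∀ ε ∈ Ioo (0 : ℝ) 1, MapsTo (g ε) (Icc a b) (Ioo a b) := by
    rintro ε ⟨h0, h1⟩ x ⟨hax, hxb⟩
    constructor <;> simp only [g] <;> nlinarith
  refine of_tendsto (l := 𝓝[>] (0 : ℝ)) (F := fun ε ↦ f ∘ g ε) ?_ fun x hx ↦ ?_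
  · filter_upwards [hε] with ε hε
    exact hf.comp ((const_mul (sub_nonneg.mpr hε.2.le) (.id _)).add (.const _ _)) (hmaps ε hε)
  · refine (hc x hx).tendsto.comp (tendsto_nhdsWithin_iff.mpr ⟨?_, ?_⟩)
    · have : Continuous fun ε ↦ g ε x := by fun_prop
      simpa [g] using (this.tendsto 0).mono_left nhdsWithin_le_nhds
    · filter_upwards [hε] with ε hε
      exact Ioo_subset_Icc_self (hmaps ε hε hx)

lemma neg_inv_add {s : ℝ} (h : ∀ x ∈ I, 0 < x + s) :
    OperatorMonotoneOn (fun x ↦ -(x + s)⁻¹) I :=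
  ((OperatorMonotoneOn.id I).add (.const s I)).neg_inv_of_pos h

lemma inv_sub {s : ℝ} (h : ∀ x ∈ I, x < s) : OperatorMonotoneOn (fun x ↦ (s - x)⁻¹) I :=
  inv_of_antitone (((OperatorMonotoneOn.id I).add (.const (-s) I)).congr fun x _ ↦ by ring)
    fun x hx ↦ sub_pos.mpr (h x hx)

end OperatorMonotoneOn

/-- The kernel of `(1 - 1/x) * (x ^ α - (2 - x) ^ α) - 2 ^ α / x` in the integral representation of
`x ^ α`. -/
lemma operatorMonotoneOn_rpowIntegrand (α : ℝ) {s : ℝ} (hs : 0 < s) :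
    OperatorMonotoneOn (fun x ↦ (1 - x⁻¹) *
      (Real.rpowIntegrand₀₁ α s x - Real.rpowIntegrand₀₁ α s (2 - x)) -
      x⁻¹ * Real.rpowIntegrand₀₁ α s 2) (Ioo 0 2) := by
  have hsα : 0 ≤ s ^ α := Real.rpow_nonneg hs.le α
  have h₁ : OperatorMonotoneOn (fun x ↦ -(x + s)⁻¹) (Ioo 0 2) :=
    .neg_inv_add fun x hx ↦ by linarith [hx.1]
  have h₂ : OperatorMonotoneOn (fun x ↦ (2 + s - x)⁻¹) (Ioo 0 2) :=
    .inv_sub fun x hx ↦ by linarith [hx.2]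
  refine ((h₁.const_mul (c := s ^ α * (1 + s) / s) (by positivity)).add
    (h₂.const_mul (c := s ^ α * (s + 1) / (s + 2)) (by positivity))).congr fun x hx ↦ ?_
  have hx0 : x ≠ 0 := hx.1.ne'
  have hxs : x + s ≠ 0 := by linarith [hx.1]
  have hys : 2 + s - x ≠ 0 := by linarith [hx.2]
  have hys' : s + (2 - x) ≠ 0 := by linarith [hx.2]
  have hs2 : s + 2 ≠ 0 := by linarith
  simp only [Real.rpowIntegrand₀₁]
  rw [add_comm s x]
  have : s + (2 - x) = 2 + s - x := by ring
  rw [this]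
  field_simp
  ring

lemma operatorMonotoneOn_rpow_sub_rpow {α : ℝ} (hα : α ∈ Ioo 0 1) :
    OperatorMonotoneOn (fun x ↦ (1 - x⁻¹) * (x ^ α - (2 - x) ^ α) - x⁻¹ * 2 ^ α) (Ioo 0 2) := by
  have hint : ∀ x : ℝ, 0 ≤ x →
      Integrable (Real.rpowIntegrand₀₁ α · x) (volume.restrict (Ioi 0)) := fun x hx ↦
    Real.integrableOn_rpowIntegrand₀₁_Ioi hα hx
  have hdiff : ∀ x ∈ Ioo (0 : ℝ) 2, Integrable (fun s ↦ Real.rpowIntegrand₀₁ α s x -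
      Real.rpowIntegrand₀₁ α s (2 - x)) (volume.restrict (Ioi 0)) := fun x hx ↦
    (hint x hx.1.le).sub (hint _ (sub_nonneg.mpr hx.2.le))
  have h2 := hint 2 zero_le_two
  refine ((OperatorMonotoneOn.integral (μ := volume.restrict (Ioi 0))
    (ae_restrict_of_forall_mem measurableSet_Ioi fun s hs ↦ operatorMonotoneOn_rpowIntegrand α hs)
    fun x hx ↦ ((hdiff x hx).const_mul _).sub (h2.const_mul _)).const_mul
    (inv_nonneg.mpr (Real.integral_rpowIntegrand₀₁_one_pos hα).le)).congr fun x hx ↦ ?_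
  have hy : 0 ≤ 2 - x := sub_nonneg.mpr hx.2.le
  simp only
  rw [integral_sub ((hdiff x hx).const_mul _) (h2.const_mul _), integral_const_mul,
    integral_const_mul, integral_sub (hint x hx.1.le) (hint _ hy),
    Real.rpow_eq_const_mul_integral hα hx.1.le, Real.rpow_eq_const_mul_integral hα hy,
    Real.rpow_eq_const_mul_integral hα zero_le_two]
  ring

lemma three_sub_mul_rpow_sub_rpow_pos {α : ℝ} (hα0 : 0 < α) (hα1 : α < 1) {x : ℝ}
    (hx : x ∈ Icc (0 : ℝ) 2) : 0 < 3 - (x - 1) * (x ^ α - (2 - x) ^ α) := by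
  have hle : ∀ y ∈ Icc (0 : ℝ) 2, y ^ α ∈ Icc (0 : ℝ) 2 := fun y hy ↦
    ⟨Real.rpow_nonneg hy.1 α, (Real.rpow_le_rpow hy.1 hy.2 hα0.le).trans
      (Real.rpow_le_self_of_one_le one_le_two hα1.le)⟩
  have h₁ := hle x hx
  have h₂ := hle (2 - x) ⟨by linarith [hx.2], by linarith [hx.1]⟩
  have habs : |(x - 1) * (x ^ α - (2 - x) ^ α)| ≤ 1 * 2 := by
    rw [abs_mul]
    gcongr
    · exact abs_le.mpr ⟨by linarith [hx.1], by linarith [hx.2]⟩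
    · exact abs_le.mpr ⟨by linarith [h₁.1, h₂.2], by linarith [h₁.2, h₂.1]⟩
  linarith [le_abs_self ((x - 1) * (x ^ α - (2 - x) ^ α))]

/-- for `0 < α < 1`, the function `x ↦ x/(3 − (x − 1)·(x^α − (2 − x)^α))` is
well defined (the denominator is strictly positive on `[0,2]`) and operator monotone
on `[0,2]`. -/
theorem stmt15 (α : ℝ) (hα0 : 0 < α) (hα1 : α < 1) :
    (∀ x ∈ Set.Icc (0 : ℝ) 2, 0 < 3 - (x - 1) * (x ^ α - (2 - x) ^ α)) ∧
    OperatorMonotoneOn (fun x => x / (3 - (x - 1) * (x ^ α - (2 - x) ^ α)))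
      (Set.Icc (0 : ℝ) 2) := by
  have hpos := fun x (hx : x ∈ Icc (0 : ℝ) 2) ↦ three_sub_mul_rpow_sub_rpow_pos hα0 hα1 hx
  refine ⟨hpos, .Icc_of_Ioo two_pos ?_ ?_⟩
  · have h2α : (2 : ℝ) ^ α ≤ 2 := Real.rpow_le_self_of_one_le one_le_two hα1.le
    have hinv : OperatorMonotoneOn (fun x ↦ -(x + 0)⁻¹) (Ioo 0 2) :=
      .neg_inv_add fun x hx ↦ by simpa using hx.1
    have hneg : OperatorMonotoneOn
        (fun x ↦ -((3 - (x - 1) * (x ^ α - (2 - x) ^ α)) / x)) (Ioo 0 2) :=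
      ((hinv.const_mul (c := 3 - 2 ^ α) (by linarith)).add
        (operatorMonotoneOn_rpow_sub_rpow ⟨hα0, hα1⟩)).congr fun x hx ↦ by
          have := hx.1.ne'
          simp only [add_zero]
          field_simp
          ring
    exact (hneg.inv_of_antitone fun x hx ↦
      div_pos (hpos x (Ioo_subset_Icc_self hx)) hx.1).congr fun x _ ↦ inv_div _ _
  · refine continuousOn_id.div ?_ fun x hx ↦ (hpos x hx).ne'
    have h₁ : Continuous fun x : ℝ ↦ x ^ α := Real.continuous_rpow_const hα0.le
    exact Continuous.continuousOn (by fun_prop)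
end

section
/- Let I ⊆ ℝ be a nondegenerate interval whose left endpoint a belongs to I, and let f : I → ℝ be continuous. Then f is operator convex on I if and only if the function g defined on I \ {a} by g(x) = (f(x) − f(a))/(x − a) is operator monotone on I \ {a}. -/
open Matrix Set
open scoped ComplexOrder

namespace Matrix

open scoped MatrixOrder Matrix.Norms.L2Operator

lemma conjTranspose_mul_mul_same_mono {m n : Type*} [Fintype m] [Fintype n]
    {A B : Matrix m m ℂ} (h : A ≤ B) (V : Matrix m n ℂ) :
    Vᴴ * A * V ≤ Vᴴ * B * V := by
  rw [le_iff, ← Matrix.sub_mul, ← Matrix.mul_sub]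
  exact (le_iff.1 h).conjTranspose_mul_mul_same V

lemma submatrix_le_submatrix_equiv {m n : Type*} {A B : Matrix n n ℂ} (e : m ≃ n) :
    A.submatrix e e ≤ B.submatrix e e ↔ A ≤ B :=
  posSemidef_submatrix_equiv (M := B - A) e

lemma fromBlocks_diagonal_isSelfAdjoint {m n : Type*} {A : Matrix m m ℂ} {B : Matrix n n ℂ}
    (hA : IsSelfAdjoint A) (hB : IsSelfAdjoint B) : IsSelfAdjoint (fromBlocks A 0 0 B) :=
  IsHermitian.fromBlocks hA (by simp) hB

lemma smul_one_eq_fromBlocks {m n : Type*} [DecidableEq m] [DecidableEq n] (c : ℝ) :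
    (c • 1 : Matrix (m ⊕ n) (m ⊕ n) ℂ) = fromBlocks (c • 1) 0 0 (c • 1) := by
  rw [← fromBlocks_one, fromBlocks_smul, smul_zero, smul_zero]

section FunctionalCalculus

variable {m n : Type*} [Fintype m] [Fintype n] [DecidableEq m] [DecidableEq n]

lemma continuousOn_real_spectrum (A : Matrix n n ℂ) (f : ℝ → ℝ) :
    ContinuousOn f (spectrum ℝ A) :=
  A.finite_real_spectrum.continuousOn f

lemma cfc_mul_eq_mul_cfc {Y : Matrix m m ℂ} {Z : Matrix n n ℂ} (hY : IsSelfAdjoint Y)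
    (hZ : IsSelfAdjoint Z) {V : Matrix m n ℂ} (h : Y * V = V * Z) (f : ℝ → ℝ) :
    cfc f Y * V = V * cfc f Z := by
  have hfin : (spectrum ℝ Y ∪ spectrum ℝ Z).Finite :=
    Y.finite_real_spectrum.union Z.finite_real_spectrum
  set p : Polynomial ℝ := Lagrange.interpolate hfin.toFinset id f
  have hp : ∀ x ∈ spectrum ℝ Y ∪ spectrum ℝ Z, f x = p.eval x := fun x hx =>
    (Lagrange.eval_interpolate_at_node f (Set.injOn_id _) (hfin.mem_toFinset.2 hx)).symm
  rw [cfc_congr (a := Y) (g := p.eval) fun x hx => hp x (Or.inl hx),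
    cfc_congr (a := Z) (g := p.eval) fun x hx => hp x (Or.inr hx),
    cfc_polynomial p Y hY, cfc_polynomial p Z hZ]
  clear hp
  clear_value p
  induction p using Polynomial.induction_on' with
  | add p q hp hq => simp only [map_add, Matrix.add_mul, Matrix.mul_add, hp, hq]
  | monomial k c =>
    have hk : Y ^ k * V = V * Z ^ k := by
      induction k with
      | zero => simp
      | succ k ih => rw [pow_succ, Matrix.mul_assoc, h, ← Matrix.mul_assoc, ih, pow_succ,
          Matrix.mul_assoc]
    simp [Polynomial.aeval_monomial, Algebra.algebraMap_eq_smul_one, hk]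

lemma spectrum_subset_Icc_iff {A : Matrix n n ℂ} (hA : IsSelfAdjoint A) {a b : ℝ} :
    spectrum ℝ A ⊆ Icc a b ↔ a • 1 ≤ A ∧ A ≤ b • 1 := by
  rw [← Algebra.algebraMap_eq_smul_one, ← Algebra.algebraMap_eq_smul_one,
    algebraMap_le_iff_le_spectrum hA, le_algebraMap_iff_spectrum_le hA]
  exact ⟨fun h => ⟨fun x hx => (h hx).1, fun x hx => (h hx).2⟩,
    fun h x hx => ⟨h.1 x hx, h.2 x hx⟩⟩

lemma spectrum_submatrix (A : Matrix n n ℂ) (e : m ≃ n) :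
    spectrum ℝ (A.submatrix e e) = spectrum ℝ A :=
  AlgEquiv.spectrum_eq (reindexAlgEquiv ℝ ℂ e.symm) A

lemma cfc_submatrix {A : Matrix n n ℂ} (hA : IsSelfAdjoint A) (e : m ≃ n) (f : ℝ → ℝ) :
    cfc f (A.submatrix e e) = (cfc f A).submatrix e e := by
  have h := cfc_mul_eq_mul_cfc (IsHermitian.submatrix hA e) hA
    (V := (1 : Matrix n n ℂ).submatrix e id) (by
      rw [submatrix_mul_equiv]
      ext i j
      simp [Matrix.mul_apply, Matrix.one_apply]) f
  ext i j
  have := congrFun (congrFun h i) (e j)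
  simpa [Matrix.mul_apply, Matrix.one_apply] using this

lemma cfc_mul_cfc (A : Matrix n n ℂ) (f g : ℝ → ℝ) :
    cfc f A * cfc g A = cfc (fun x => f x * g x) A :=
  (cfc_mul f g A (continuousOn_real_spectrum A f) (continuousOn_real_spectrum A g)).symm

lemma cfc_sub_const {A : Matrix n n ℂ} (hA : IsSelfAdjoint A) (f : ℝ → ℝ) (c : ℝ) :
    cfc (fun x => f x - c) A = cfc f A - c • 1 := by
  rw [cfc_sub f (fun _ => c) A (continuousOn_real_spectrum A f) continuousOn_const,
    cfc_const c A hA, Algebra.algebraMap_eq_smul_one]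

lemma fromBlocks_diagonal_mono {A A' : Matrix m m ℂ} {B B' : Matrix n n ℂ} (hA : A ≤ A')
    (hB : B ≤ B') : fromBlocks A 0 0 B ≤ fromBlocks A' 0 0 B' := by
  let E : Matrix m (m ⊕ n) ℂ := fromCols 1 0
  let F : Matrix n (m ⊕ n) ℂ := fromCols 0 1
  have key : ∀ (P : Matrix m m ℂ) (Q : Matrix n n ℂ),
      fromBlocks P 0 0 Q = Eᴴ * P * E + Fᴴ * Q * F := by
    intro P Q
    rw [conjTranspose_fromCols_eq_fromRows_conjTranspose,
      conjTranspose_fromCols_eq_fromRows_conjTranspose, fromRows_mul, fromRows_mul _ _ Q,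
      fromRows_mul_fromCols, fromRows_mul_fromCols, fromBlocks_add]
    simp
  rw [key A B, key A' B']
  exact add_le_add (conjTranspose_mul_mul_same_mono hA E) (conjTranspose_mul_mul_same_mono hB F)

lemma cfc_fromBlocks_diagonal {A : Matrix m m ℂ} {B : Matrix n n ℂ}
    (hA : IsSelfAdjoint A) (hB : IsSelfAdjoint B) (f : ℝ → ℝ) :
    cfc f (fromBlocks A 0 0 B) = fromBlocks (cfc f A) 0 0 (cfc f B) := by
  have hX := fromBlocks_diagonal_isSelfAdjoint hA hB
  have h1 := cfc_mul_eq_mul_cfc hX hA (V := fromRows 1 0)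
    (by simp [fromBlocks_mul_fromRows, fromRows_mul]) f
  have h2 := cfc_mul_eq_mul_cfc hX hB (V := fromRows 0 1)
    (by simp [fromBlocks_mul_fromRows, fromRows_mul]) f
  rw [← fromBlocks_toBlocks (cfc f (fromBlocks A 0 0 B))] at h1 h2 ⊢
  simp only [fromBlocks_mul_fromRows, fromRows_mul, Matrix.mul_one, Matrix.one_mul,
    Matrix.mul_zero, Matrix.zero_mul, add_zero, zero_add, fromRows_inj.eq_iff] at h1 h2
  rw [h1.1, h1.2, h2.1, h2.2]

end FunctionalCalculus

section Order

variable {ι : Type*} [Fintype ι] [DecidableEq ι]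

lemma _root_.OperatorMonotoneOn.cfc_le_cfc {f : ℝ → ℝ} {I : Set ℝ} (h : OperatorMonotoneOn f I)
    {A B : Matrix ι ι ℂ} (hA : IsSelfAdjoint A) (hB : IsSelfAdjoint B)
    (hAI : spectrum ℝ A ⊆ I) (hBI : spectrum ℝ B ⊆ I) (hAB : A ≤ B) : cfc f A ≤ cfc f B := by
  cases isEmpty_or_nonempty ι
  · exact (Subsingleton.elim _ _).le
  let e := (Fintype.equivFin ι).symm
  have hA' : (A.submatrix e e).IsHermitian := IsHermitian.submatrix hA e
  have hB' : (B.submatrix e e).IsHermitian := IsHermitian.submatrix hB e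
  have := h (Fintype.card ι) Fintype.card_pos _ _ hA' hB'
    (fun i => hAI (spectrum_submatrix A e ▸ hA'.eigenvalues_mem_spectrum_real i))
    (fun i => hBI (spectrum_submatrix B e ▸ hB'.eigenvalues_mem_spectrum_real i))
    ((submatrix_le_submatrix_equiv e).2 hAB)
  rw [← hA'.cfc_eq, ← hB'.cfc_eq, cfc_submatrix hA, cfc_submatrix hB] at this
  exact (submatrix_le_submatrix_equiv e).1 this

lemma _root_.OperatorConvexOn.cfc_midpoint_le {f : ℝ → ℝ} {I : Set ℝ} (h : OperatorConvexOn f I)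
    {A B : Matrix ι ι ℂ} (hA : IsSelfAdjoint A) (hB : IsSelfAdjoint B)
    (hAI : spectrum ℝ A ⊆ I) (hBI : spectrum ℝ B ⊆ I) :
    cfc f ((1 / 2 : ℂ) • (A + B)) ≤ (1 / 2 : ℂ) • (cfc f A + cfc f B) := by
  cases isEmpty_or_nonempty ι
  · exact (Subsingleton.elim _ _).le
  let e := (Fintype.equivFin ι).symm
  have hA' : (A.submatrix e e).IsHermitian := IsHermitian.submatrix hA e
  have hB' : (B.submatrix e e).IsHermitian := IsHermitian.submatrix hB e
  have hM : IsSelfAdjoint ((1 / 2 : ℂ) • (A + B)) :=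
    .smul (by simp [IsSelfAdjoint]) (hA.add hB)
  have h2 : (1 : ℂ) - ((1 / 2 : ℝ) : ℂ) = ((1 / 2 : ℝ) : ℂ) := by norm_num
  have heq : ((1 / 2 : ℂ) • (A + B)).submatrix e e = (((1 / 2 : ℝ) : ℂ) • A.submatrix e e +
      ((1 : ℂ) - ((1 / 2 : ℝ) : ℂ)) • B.submatrix e e) := by
    rw [h2, smul_add]
    push_cast
    rfl
  have hM' := heq ▸ IsHermitian.submatrix hM e
  have := h (Fintype.card ι) Fintype.card_pos (1 / 2) (by norm_num) _ _ hA' hB' hM'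
    (fun i => hAI (spectrum_submatrix A e ▸ hA'.eigenvalues_mem_spectrum_real i))
    (fun i => hBI (spectrum_submatrix B e ▸ hB'.eigenvalues_mem_spectrum_real i))
  rw [← hA'.cfc_eq, ← hB'.cfc_eq, ← hM'.cfc_eq, ← heq, cfc_submatrix hA, cfc_submatrix hB,
    cfc_submatrix hM, h2, ← smul_add] at this
  refine (submatrix_le_submatrix_equiv e).1 (le_iff.2 ?_)
  convert! this using 3
  push_cast
  rfl

lemma _root_.OperatorConvexOn.cfc_conjTranspose_mul_mul_same_le {κ : Type*} [Fintype κ]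
    [DecidableEq κ] {f : ℝ → ℝ} {I : Set ℝ} (h : OperatorConvexOn f I)
    {X : Matrix ι ι ℂ} (hX : IsSelfAdjoint X) (hXI : spectrum ℝ X ⊆ I) {V : Matrix ι κ ℂ}
    (hV : Vᴴ * V = 1) : cfc f (Vᴴ * X * V) ≤ Vᴴ * cfc f X * V := by
  set U : Matrix ι ι ℂ := (2 : ℂ) • (V * Vᴴ) - 1 with hU
  have hUs : IsSelfAdjoint U := by
    simp [IsSelfAdjoint, star_eq_conjTranspose, hU]
  have hUV : U * V = V := by
    rw [hU, Matrix.sub_mul, Matrix.smul_mul, Matrix.mul_assoc, hV, Matrix.mul_one, Matrix.one_mul]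
    module
  have hVU : Vᴴ * U = Vᴴ := by
    rw [hU, Matrix.mul_sub, Matrix.mul_smul, ← Matrix.mul_assoc, hV, Matrix.mul_one,
      Matrix.one_mul]
    module
  have hUU : U * U = 1 := by
    conv_lhs => enter [2]; rw [hU]
    rw [Matrix.mul_sub, Matrix.mul_smul, ← Matrix.mul_assoc, hUV, Matrix.mul_one, hU]
    module
  have hX2 : IsSelfAdjoint (U * X * U) := by
    simpa [hUs.star_eq] using hX.conjugate U
  have hX2I : spectrum ℝ (U * X * U) ⊆ I := by
    have := spectrum.units_conjugate (R := ℝ) (a := X) (u := ⟨U, U, hUU, hUU⟩)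
    exact this.subset.trans hXI
  have hf2 : cfc f (U * X * U) = U * cfc f X * U := by
    have := cfc_mul_eq_mul_cfc hX2 hX (V := U) (by rw [Matrix.mul_assoc, hUU, Matrix.mul_one]) f
    rw [← this, Matrix.mul_assoc _ U U, hUU, Matrix.mul_one]
  have hmid := h.cfc_midpoint_le hX hX2 hXI hX2I
  have hZ : IsSelfAdjoint (Vᴴ * X * V) := isHermitian_conjTranspose_mul_mul V hX
  have hY : IsSelfAdjoint ((1 / 2 : ℂ) • (X + U * X * U)) :=
    .smul (by simp [IsSelfAdjoint]) (hX.add hX2)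
  have hYV : (1 / 2 : ℂ) • (X + U * X * U) * V = V * (Vᴴ * X * V) := by
    rw [Matrix.smul_mul, Matrix.add_mul, Matrix.mul_assoc (U * X), hUV, hU]
    simp only [Matrix.sub_mul, Matrix.smul_mul, Matrix.one_mul, Matrix.mul_assoc]
    module
  have hfY := cfc_mul_eq_mul_cfc hY hZ hYV f
  calc cfc f (Vᴴ * X * V) = Vᴴ * cfc f ((1 / 2 : ℂ) • (X + U * X * U)) * V := by
        rw [Matrix.mul_assoc Vᴴ (cfc f _) V, hfY, ← Matrix.mul_assoc, hV, Matrix.one_mul]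
    _ ≤ Vᴴ * ((1 / 2 : ℂ) • (cfc f X + cfc f (U * X * U))) * V :=
        conjTranspose_mul_mul_same_mono hmid V
    _ = Vᴴ * cfc f X * V := by
        rw [hf2, Matrix.mul_smul, Matrix.smul_mul, Matrix.mul_add, Matrix.add_mul,
          Matrix.mul_assoc Vᴴ (U * cfc f X * U) V, Matrix.mul_assoc (U * cfc f X) U V, hUV,
          Matrix.mul_assoc U (cfc f X) V, ← Matrix.mul_assoc Vᴴ U, hVU, Matrix.mul_assoc]
        module

lemma _root_.OperatorConvexOn.cfc_contraction_le {f : ℝ → ℝ} {a b : ℝ}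
    (h : OperatorConvexOn f (Set.Icc a b)) {B : Matrix ι ι ℂ} (hB : IsSelfAdjoint B)
    (hBI : spectrum ℝ B ⊆ Set.Icc a b) {K : Matrix ι ι ℂ} (hK : Kᴴ * K ≤ 1) :
    cfc f (a • 1 + Kᴴ * (B - a • 1) * K) ≤ f a • 1 + Kᴴ * (cfc f B - f a • 1) * K := by
  obtain ⟨D, hD⟩ := CStarAlgebra.nonneg_iff_eq_star_mul_self.1 (sub_nonneg.2 hK)
  rw [star_eq_conjTranspose] at hD
  have ha : IsSelfAdjoint (a • 1 : Matrix ι ι ℂ) := .smul (by simp [IsSelfAdjoint]) (.one _)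
  have hX := fromBlocks_diagonal_isSelfAdjoint hB ha
  have hXI : spectrum ℝ (fromBlocks B 0 0 (a • 1 : Matrix ι ι ℂ)) ⊆ Set.Icc a b := by
    rw [spectrum_subset_Icc_iff hX, smul_one_eq_fromBlocks, smul_one_eq_fromBlocks]
    rw [spectrum_subset_Icc_iff hB] at hBI
    exact ⟨fromBlocks_diagonal_mono hBI.1 le_rfl,
      fromBlocks_diagonal_mono hBI.2 (hBI.1.trans hBI.2)⟩
  have hV : (fromRows K D)ᴴ * fromRows K D = 1 := by
    rw [conjTranspose_fromRows_eq_fromCols_conjTranspose, fromCols_mul_fromRows, ← hD]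
    abel
  have hfa : cfc f (a • 1 : Matrix ι ι ℂ) = f a • 1 := by
    rw [← Algebra.algebraMap_eq_smul_one, cfc_algebraMap, Algebra.algebraMap_eq_smul_one]
  have hcompress : ∀ (M : Matrix ι ι ℂ) (c : ℝ), (fromRows K D)ᴴ *
      fromBlocks M 0 0 (c • 1 : Matrix ι ι ℂ) * fromRows K D = c • 1 + Kᴴ * (M - c • 1) * K := by
    intro M c
    simp only [conjTranspose_fromRows_eq_fromCols_conjTranspose, Matrix.mul_assoc,
      fromBlocks_mul_fromRows, fromCols_mul_fromRows, Matrix.zero_mul, add_zero, zero_add,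
      Matrix.smul_mul, Matrix.one_mul, Matrix.mul_smul, ← hD, Matrix.sub_mul, Matrix.mul_sub,
      smul_sub]
    abel
  have := h.cfc_conjTranspose_mul_mul_same_le hX hXI hV
  rwa [cfc_fromBlocks_diagonal hB ha, hfa, hcompress, hcompress] at this

lemma cfc_sqrt_mul_cfc_inv_sqrt {M : Matrix ι ι ℂ} (hM : IsSelfAdjoint M) {a : ℝ}
    (h : ∀ x ∈ spectrum ℝ M, a < x) :
    cfc (fun x => √(x - a)) M * cfc (fun x => (√(x - a))⁻¹) M = 1 := by
  rw [cfc_mul_cfc, ← cfc_const_one ℝ M hM]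
  exact cfc_congr fun x hx => mul_inv_cancel₀ (Real.sqrt_pos.2 (sub_pos.2 (h x hx))).ne'

lemma cfc_sqrt_mul_self {M : Matrix ι ι ℂ} (hM : IsSelfAdjoint M) {a : ℝ}
    (h : ∀ x ∈ spectrum ℝ M, a < x) :
    cfc (fun x => √(x - a)) M * cfc (fun x => √(x - a)) M = M - a • 1 := by
  rw [cfc_mul_cfc, cfc_congr fun x hx => Real.mul_self_sqrt (sub_pos.2 (h x hx)).le,
    cfc_sub_const hM (fun x => x) a, cfc_id' ℝ M hM]

lemma cfc_sqrt_mul_cfc_slope_mul_cfc_sqrt {M : Matrix ι ι ℂ} (hM : IsSelfAdjoint M) {a : ℝ}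
    (h : ∀ x ∈ spectrum ℝ M, a < x) (f : ℝ → ℝ) :
    cfc (fun x => √(x - a)) M * cfc (fun x => (f x - f a) / (x - a)) M *
      cfc (fun x => √(x - a)) M = cfc f M - f a • 1 := by
  rw [← cfc_sub_const hM, cfc_mul_cfc, cfc_mul_cfc]
  refine cfc_congr fun x hx => ?_
  have hx' := sub_pos.2 (h x hx)
  change √(x - a) * ((f x - f a) / (x - a)) * √(x - a) = f x - f a
  rw [mul_right_comm, Real.mul_self_sqrt hx'.le, mul_div_cancel₀ _ hx'.ne']

lemma conjTranspose_cfc (M : Matrix ι ι ℂ) (φ : ℝ → ℝ) : (cfc φ M)ᴴ = cfc φ M :=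
  (cfc_predicate φ M : IsSelfAdjoint _)

lemma conjTranspose_mul_self_le_one {K : Matrix ι ι ℂ} (h : K * Kᴴ ≤ 1) : Kᴴ * K ≤ 1 := by
  rw [← star_eq_conjTranspose] at h ⊢
  rw [← CStarAlgebra.norm_le_one_iff_of_nonneg _ (mul_star_self_nonneg K),
    CStarRing.norm_self_mul_star] at h
  rwa [← CStarAlgebra.norm_le_one_iff_of_nonneg _ (star_mul_self_nonneg K),
    CStarRing.norm_star_mul_self]

lemma _root_.OperatorConvexOn.cfc_slope_le {f : ℝ → ℝ} {a b : ℝ}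
    (h : OperatorConvexOn f (Set.Icc a b)) {A B : Matrix ι ι ℂ} (hA : IsSelfAdjoint A)
    (hB : IsSelfAdjoint B) (hAI : spectrum ℝ A ⊆ Set.Ioc a b) (hBI : spectrum ℝ B ⊆ Set.Ioc a b)
    (hAB : A ≤ B) :
    cfc (fun x => (f x - f a) / (x - a)) A ≤ cfc (fun x => (f x - f a) / (x - a)) B := by
  have hA1 := cfc_sqrt_mul_cfc_inv_sqrt hA fun x hx => (hAI hx).1
  have hB1 := cfc_sqrt_mul_cfc_inv_sqrt hB fun x hx => (hBI hx).1
  have hA2 := cfc_sqrt_mul_self hA fun x hx => (hAI hx).1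
  have hB2 := cfc_sqrt_mul_self hB fun x hx => (hBI hx).1
  have hA3 := cfc_sqrt_mul_cfc_slope_mul_cfc_sqrt hA (fun x hx => (hAI hx).1) f
  have hB3 := cfc_sqrt_mul_cfc_slope_mul_cfc_sqrt hB (fun x hx => (hBI hx).1) f
  have hR := conjTranspose_cfc A fun x => √(x - a)
  have hQ := conjTranspose_cfc A fun x => (√(x - a))⁻¹
  have hT := conjTranspose_cfc B fun x => (√(x - a))⁻¹
  generalize cfc (fun x => (f x - f a) / (x - a)) A = GA at hA3 ⊢
  generalize cfc (fun x => (f x - f a) / (x - a)) B = GB at hB3 ⊢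
  generalize cfc (fun x => √(x - a)) A = R at *
  generalize cfc (fun x => (√(x - a))⁻¹) A = Q at *
  generalize cfc (fun x => √(x - a)) B = S at *
  generalize cfc (fun x => (√(x - a))⁻¹) B = T at *
  have hA1' := mul_eq_one_comm.1 hA1
  have hB1' := mul_eq_one_comm.1 hB1
  have hKs : (T * R)ᴴ = R * T := by rw [conjTranspose_mul, hR, hT]
  have hKAB : (T * R)ᴴ * (B - a • 1) * (T * R) = A - a • 1 := by
    rw [← hB2, hKs, ← hA2]
    calc R * T * (S * S) * (T * R) = R * (T * S) * (S * T) * R := by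
          simp only [Matrix.mul_assoc]
      _ = R * R := by rw [hB1, hB1', Matrix.mul_one, Matrix.mul_one]
  have hKK : (T * R) * (T * R)ᴴ ≤ 1 := by
    have h1 : (T * R) * (T * R)ᴴ = Tᴴ * (A - a • 1) * T := by
      rw [hKs, ← hA2, hT]
      simp only [Matrix.mul_assoc]
    have h2 : (1 : Matrix ι ι ℂ) = Tᴴ * (B - a • 1) * T := by
      rw [← hB2, hT]
      calc (1 : Matrix ι ι ℂ) = (T * S) * (S * T) := by rw [hB1, hB1', Matrix.mul_one]
        _ = _ := by simp only [Matrix.mul_assoc]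
    exact h1.trans_le ((conjTranspose_mul_mul_same_mono (sub_le_sub_right hAB _) _).trans_eq
      h2.symm)
  have hmain := h.cfc_contraction_le hB (hBI.trans Set.Ioc_subset_Icc_self)
    (conjTranspose_mul_self_le_one hKK)
  rw [hKAB, add_sub_cancel, ← sub_le_iff_le_add', ← hA3, ← hB3, hKs] at hmain
  have := conjTranspose_mul_mul_same_mono hmain Q
  rw [hQ] at this
  calc GA = (Q * R) * GA * (R * Q) := by rw [hA1, hA1', Matrix.one_mul, Matrix.mul_one]
    _ = Q * (R * GA * R) * Q := by simp only [Matrix.mul_assoc]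
    _ ≤ Q * (R * T * (S * GB * S) * (T * R)) * Q := this
    _ = (Q * R) * (T * S) * GB * (S * T) * (R * Q) := by simp only [Matrix.mul_assoc]
    _ = GB := by rw [hA1, hA1', hB1, hB1']; simp only [Matrix.one_mul, Matrix.mul_one]

lemma _root_.OperatorMonotoneOn.cfc_conjugate_le {f : ℝ → ℝ} {a b : ℝ}
    (h : OperatorMonotoneOn (fun x => (f x - f a) / (x - a)) (Set.Ioc a b)) {X C : Matrix ι ι ℂ}
    (hX : IsSelfAdjoint X) (hC : IsSelfAdjoint C) {δ s : ℝ} (hδ : 0 < δ) (hs : 0 < s)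
    (hXa : (a + δ) • 1 ≤ X) (hXb : X ≤ b • 1) (hCs : s • 1 ≤ C * C) (hC1 : C * C ≤ 1) :
    cfc f (a • 1 + C * (X - a • 1) * C) - f a • 1 ≤ C * (cfc f X - f a • 1) * C := by
  have hXI : spectrum ℝ X ⊆ Set.Ioc a b :=
    ((spectrum_subset_Icc_iff hX).2 ⟨hXa, hXb⟩).trans fun x hx => ⟨by linarith [hx.1], hx.2⟩
  have hR2 := cfc_sqrt_mul_self hX fun x hx => (hXI hx).1
  have hR3 := cfc_sqrt_mul_cfc_slope_mul_cfc_sqrt hX (fun x hx => (hXI hx).1) f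
  have hR := conjTranspose_cfc X fun x => √(x - a)
  generalize cfc (fun x => √(x - a)) X = R at *
  have hC' : Cᴴ = C := hC
  have ha : IsSelfAdjoint (a • 1 : Matrix ι ι ℂ) := .smul (by simp [IsSelfAdjoint]) (.one _)
  have hY : IsSelfAdjoint (a • 1 + C * (X - a • 1) * C) := by
    refine ha.add ?_
    simpa [hC.star_eq] using (hX.sub ha).conjugate C
  have hW : IsSelfAdjoint (a • 1 + R * (C * C) * R) := by
    refine ha.add ?_
    have h2 : IsSelfAdjoint (C * C) := by simpa [hC.star_eq] using IsSelfAdjoint.mul_star_self C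
    simpa [star_eq_conjTranspose, hR] using h2.conjugate R
  have hWX : a • 1 + R * (C * C) * R ≤ X := by
    have := conjTranspose_mul_mul_same_mono hC1 R
    rw [hR, Matrix.mul_one, hR2] at this
    simpa using add_le_add_right this (a • 1)
  have hWI : spectrum ℝ (a • 1 + R * (C * C) * R) ⊆ Set.Ioc a b := by
    refine ((spectrum_subset_Icc_iff hW (a := a + s * δ)).2 ⟨?_, hWX.trans hXb⟩).trans
      fun x hx => ⟨by nlinarith [hx.1, mul_pos hs hδ], hx.2⟩
    have h1 := conjTranspose_mul_mul_same_mono hCs R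
    rw [hR, Matrix.mul_smul, Matrix.mul_one, Matrix.smul_mul, hR2] at h1
    have h2 : δ • (1 : Matrix ι ι ℂ) ≤ X - a • 1 := by
      rw [le_sub_iff_add_le, ← add_smul, add_comm]
      exact hXa
    rw [add_smul, mul_smul]
    gcongr
    exact (smul_le_smul_of_nonneg_left h2 hs.le).trans h1
  have hmono := h.cfc_le_cfc hW hX hWI hXI hWX
  have hYW : (a • 1 + C * (X - a • 1) * C) * (C * R) =
      (C * R) * (a • 1 + R * (C * C) * R) := by
    rw [← hR2]
    simp only [Matrix.add_mul, Matrix.mul_add, Matrix.mul_assoc, Matrix.smul_mul, Matrix.mul_smul,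
      Matrix.one_mul, Matrix.mul_one]
  have hgY := cfc_mul_eq_mul_cfc hY hW hYW fun x => (f x - f a) / (x - a)
  have hfY : cfc f (a • 1 + C * (X - a • 1) * C) - f a • 1 =
      cfc (fun x => (f x - f a) / (x - a)) (a • 1 + C * (X - a • 1) * C) *
        (C * (X - a • 1) * C) := by
    conv_rhs => enter [2]; rw [← add_sub_cancel_left (a • 1) (C * (X - a • 1) * C)]
    rw [← cfc_sub_const hY]
    conv_rhs => enter [2, 1]; rw [← cfc_id' ℝ _ hY]
    rw [← cfc_sub_const hY, cfc_mul_cfc]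
    refine cfc_congr fun x _ => ?_
    by_cases hx : x - a = 0
    · simp [sub_eq_zero.1 hx]
    · exact (div_mul_cancel₀ _ hx).symm
  generalize cfc (fun x => (f x - f a) / (x - a)) (a • 1 + C * (X - a • 1) * C) = GY at *
  generalize cfc (fun x => (f x - f a) / (x - a)) X = GX at *
  generalize cfc (fun x => (f x - f a) / (x - a)) (a • 1 + R * (C * C) * R) = GW at *
  calc _ = GY * (C * (X - a • 1) * C) := hfY
    _ = (GY * (C * R)) * (R * C) := by rw [← hR2]; simp only [Matrix.mul_assoc]
    _ = (R * C)ᴴ * GW * (R * C) := by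
      rw [hgY, conjTranspose_mul, hR, hC']
    _ ≤ (R * C)ᴴ * GX * (R * C) := conjTranspose_mul_mul_same_mono hmono _
    _ = C * (R * GX * R) * C := by
      rw [conjTranspose_mul, hR, hC']
      simp only [Matrix.mul_assoc]
    _ = _ := by rw [hR3]

lemma _root_.OperatorMonotoneOn.cfc_conjTranspose_mul_mul_same_le {κ : Type*} [Fintype κ]
    [DecidableEq κ] {f : ℝ → ℝ} {a b : ℝ} (hab : a < b) (hf : ContinuousOn f (Set.Icc a b))
    (h : OperatorMonotoneOn (fun x => (f x - f a) / (x - a)) (Set.Ioc a b)) {X : Matrix ι ι ℂ}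
    (hX : IsSelfAdjoint X) (hXI : spectrum ℝ X ⊆ Set.Icc a b) {V : Matrix ι κ ℂ}
    (hV : Vᴴ * V = 1) : cfc f (Vᴴ * X * V) ≤ Vᴴ * cfc f X * V := by
  obtain ⟨hXa, hXb⟩ := (spectrum_subset_Icc_iff hX).1 hXI
  set P : Matrix ι ι ℂ := V * Vᴴ with hP
  have hPP : P * P = P := by
    rw [hP, Matrix.mul_assoc, ← Matrix.mul_assoc Vᴴ, hV, Matrix.one_mul]
  have hPs : IsSelfAdjoint P := by simp [IsSelfAdjoint, star_eq_conjTranspose, hP]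
  have hVP : Vᴴ * P = Vᴴ := by rw [hP, ← Matrix.mul_assoc, hV, Matrix.one_mul]
  have hPV : P * V = V := by rw [hP, Matrix.mul_assoc, hV, Matrix.mul_one]
  have hP0 : 0 ≤ P := by
    have := mul_star_self_nonneg P
    rwa [hPs.star_eq, hPP] at this
  have hsP : IsSelfAdjoint (1 - P) := (IsSelfAdjoint.one _).sub hPs
  have hQQ : (1 - P) * (1 - P) = 1 - P := by
    rw [Matrix.mul_sub, Matrix.sub_mul, Matrix.sub_mul, hPP]
    simp
  have hP1 : 0 ≤ 1 - P := by
    have := mul_star_self_nonneg (1 - P)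
    rwa [hsP.star_eq, hQQ] at this
  let C : ℝ → Matrix ι ι ℂ := fun s => P + s • (1 - P)
  let Z : ℝ → Matrix ι ι ℂ := fun s => (1 - s) • X + (s * b) • 1
  let Y : ℝ → Matrix ι ι ℂ := fun s => a • 1 + C s * (Z s - a • 1) * C s
  have hCc : Continuous C := by fun_prop
  have hZc : Continuous Z := by fun_prop
  have hYc : Continuous Y := by fun_prop
  have hone : ∀ c : ℝ, IsSelfAdjoint (c • 1 : Matrix ι ι ℂ) := fun c =>
    .smul (by simp [IsSelfAdjoint]) (.one _)
  have hCs : ∀ s, IsSelfAdjoint (C s) := fun s =>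
    hPs.add (.smul (by simp [IsSelfAdjoint]) hsP)
  have hZs : ∀ s, IsSelfAdjoint (Z s) := fun s =>
    (IsSelfAdjoint.smul (by simp [IsSelfAdjoint]) hX).add (hone _)
  have hYs : ∀ s, IsSelfAdjoint (Y s) := fun s => by
    refine (hone a).add ?_
    simpa [(hCs s).star_eq] using ((hZs s).sub (hone a)).conjugate (C s)
  have hCC : ∀ s, C s * C s = P + (s * s) • (1 - P) := fun s => by
    have h1 : P * (1 - P) = 0 := by rw [Matrix.mul_sub, hPP, Matrix.mul_one, sub_self]
    have h2 : (1 - P) * P = 0 := by rw [Matrix.sub_mul, hPP, Matrix.one_mul, sub_self]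
    simp only [C, Matrix.add_mul, Matrix.mul_add, Matrix.smul_mul, Matrix.mul_smul, hPP, h1, h2,
      hQQ, smul_zero, add_zero, zero_add, smul_smul]
  have hC1 : ∀ s ∈ Set.Icc (0 : ℝ) 1, C s * C s ≤ 1 := fun s hs => by
    rw [hCC, ← sub_nonneg]
    have : 1 - (P + (s * s) • (1 - P)) = (1 - s * s) • (1 - P) := by module
    rw [this]
    exact smul_nonneg (by nlinarith [hs.1, hs.2]) hP1
  have hC2 : ∀ s ∈ Set.Icc (0 : ℝ) 1, (s * s) • 1 ≤ C s * C s := fun s hs => by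
    rw [hCC, ← sub_nonneg]
    have : P + (s * s) • (1 - P) - (s * s) • 1 = (1 - s * s) • P := by module
    rw [this]
    exact smul_nonneg (by nlinarith [hs.1, hs.2]) hP0
  have hZa : ∀ s ∈ Set.Icc (0 : ℝ) 1, (a + s * (b - a)) • 1 ≤ Z s := fun s hs => by
    have := smul_le_smul_of_nonneg_left hXa (sub_nonneg.2 hs.2)
    calc (a + s * (b - a)) • (1 : Matrix ι ι ℂ) = (1 - s) • (a • 1) + (s * b) • 1 := by module
      _ ≤ Z s := add_le_add_left this _
  have hZb : ∀ s ∈ Set.Icc (0 : ℝ) 1, Z s ≤ b • 1 := fun s hs => by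
    have := smul_le_smul_of_nonneg_left hXb (sub_nonneg.2 hs.2)
    calc Z s ≤ (1 - s) • (b • (1 : Matrix ι ι ℂ)) + (s * b) • 1 := add_le_add_left this _
      _ = b • 1 := by module
  have hZI : ∀ s ∈ Set.Icc (0 : ℝ) 1, spectrum ℝ (Z s) ⊆ Set.Icc a b := fun s hs => by
    refine (spectrum_subset_Icc_iff (hZs s)).2 ⟨?_, hZb s hs⟩
    refine le_trans ?_ (hZa s hs)
    rw [add_smul]
    exact le_add_of_nonneg_right (smul_nonneg (mul_nonneg hs.1 (by linarith)) zero_le_one)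
  have hYI : ∀ s ∈ Set.Icc (0 : ℝ) 1, spectrum ℝ (Y s) ⊆ Set.Icc a b := fun s hs => by
    have hZ := (spectrum_subset_Icc_iff (hZs s)).1 (hZI s hs)
    have hCs' : (C s)ᴴ = C s := hCs s
    refine (spectrum_subset_Icc_iff (hYs s)).2 ⟨?_, ?_⟩
    · have := conjTranspose_mul_mul_same_mono (sub_nonneg.2 hZ.1) (C s)
      rw [hCs', Matrix.mul_zero, Matrix.zero_mul] at this
      exact le_add_of_nonneg_right this
    · have h1 := conjTranspose_mul_mul_same_mono (sub_le_sub_right hZ.2 (a • 1)) (C s)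
      rw [hCs', ← sub_smul b a, Matrix.mul_smul, Matrix.mul_one, Matrix.smul_mul] at h1
      have h2 := h1.trans (smul_le_smul_of_nonneg_left (hC1 s hs) (sub_nonneg.2 hab.le))
      calc Y s ≤ a • 1 + (b - a) • 1 := add_le_add_right h2 _
        _ = b • 1 := by module
  have h01 : ∀ᶠ s in nhdsWithin (0 : ℝ) (Set.Ioi 0), s ∈ Set.Ioc (0 : ℝ) 1 :=
    Ioc_mem_nhdsGT one_pos
  have h01' : ∀ᶠ s in nhdsWithin (0 : ℝ) (Set.Ioi 0), s ∈ Set.Icc (0 : ℝ) 1 :=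
    h01.mono fun s hs => Set.Ioc_subset_Icc_self hs
  have h0 : (0 : ℝ) ∈ Set.Icc (0 : ℝ) 1 := by simp
  have hlim : ∀ {F : ℝ → Matrix ι ι ℂ}, Continuous F →
      Filter.Tendsto F (nhdsWithin 0 (Set.Ioi 0)) (nhds (F 0)) := fun hF =>
    hF.continuousAt.tendsto.mono_left nhdsWithin_le_nhds
  have hYlim := Filter.Tendsto.cfc isCompact_Icc f (hlim hYc) (h01'.mono hYI)
    (.of_forall hYs) (hYI 0 h0) (hYs 0) hf
  have hZlim := Filter.Tendsto.cfc isCompact_Icc f (hlim hZc) (h01'.mono hZI)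
    (.of_forall hZs) (hZI 0 h0) (hZs 0) hf
  have hle := le_of_tendsto_of_tendsto (hYlim.sub_const (f a • 1))
    (((hlim hCc).mul (hZlim.sub_const (f a • 1))).mul (hlim hCc)) (h01.mono fun s hs => by
      have hs' := Set.Ioc_subset_Icc_self hs
      exact h.cfc_conjugate_le (hZs s) (hCs s) (mul_pos hs.1 (sub_pos.2 hab))
        (mul_pos hs.1 hs.1) (hZa s hs') (hZb s hs') (hC2 s hs') (hC1 s hs'))
  have hC0 : C 0 = P := by simp [C]
  have hZ0 : Z 0 = X := by simp [Z]
  have hY0 : Y 0 * V = V * (Vᴴ * X * V) := by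
    simp only [Y, hC0, hZ0, Matrix.add_mul, Matrix.mul_assoc, hPV, Matrix.sub_mul, Matrix.mul_sub,
      Matrix.smul_mul, Matrix.mul_smul, Matrix.one_mul]
    rw [hP, Matrix.mul_assoc]
    abel
  have hfY := cfc_mul_eq_mul_cfc (hYs 0) (isHermitian_conjTranspose_mul_mul V hX) hY0 f
  rw [hC0, hZ0] at hle
  have := conjTranspose_mul_mul_same_mono hle V
  simp only [Matrix.mul_sub, Matrix.sub_mul, Matrix.mul_assoc, hPV, hfY, Matrix.smul_mul,
    Matrix.mul_smul, Matrix.one_mul, hV] at this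
  simp only [← Matrix.mul_assoc, hVP, hV, Matrix.one_mul] at this
  simpa [Matrix.mul_assoc] using this

lemma _root_.OperatorMonotoneOn.cfc_convex_combination_le {f : ℝ → ℝ} {a b : ℝ} (hab : a < b)
    (hf : ContinuousOn f (Set.Icc a b))
    (h : OperatorMonotoneOn (fun x => (f x - f a) / (x - a)) (Set.Ioc a b)) {A B : Matrix ι ι ℂ}
    (hA : IsSelfAdjoint A) (hB : IsSelfAdjoint B) (hAI : spectrum ℝ A ⊆ Set.Icc a b)
    (hBI : spectrum ℝ B ⊆ Set.Icc a b) {t : ℝ} (ht : t ∈ Set.Icc (0 : ℝ) 1) :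
    cfc f (t • A + (1 - t) • B) ≤ t • cfc f A + (1 - t) • cfc f B := by
  let V : Matrix (ι ⊕ ι) ι ℂ := fromRows (√t • 1) (√(1 - t) • 1)
  have hcomp : ∀ P Q : Matrix ι ι ℂ,
      Vᴴ * fromBlocks P 0 0 Q * V = t • P + (1 - t) • Q := by
    intro P Q
    simp only [V, conjTranspose_fromRows_eq_fromCols_conjTranspose, Matrix.mul_assoc,
      fromBlocks_mul_fromRows, fromCols_mul_fromRows, add_zero, zero_add, smul_zero,
      Matrix.smul_mul, Matrix.one_mul, Matrix.mul_smul, Matrix.mul_one, conjTranspose_smul,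
      conjTranspose_one, smul_smul, star_trivial]
    rw [Real.mul_self_sqrt ht.1, Real.mul_self_sqrt (sub_nonneg.2 ht.2)]
  have hV : Vᴴ * V = 1 := by
    have := hcomp 1 1
    rwa [fromBlocks_one, Matrix.mul_one, ← add_smul, add_sub_cancel, one_smul] at this
  have hX := fromBlocks_diagonal_isSelfAdjoint hA hB
  have hXI : spectrum ℝ (fromBlocks A 0 0 B) ⊆ Set.Icc a b := by
    rw [spectrum_subset_Icc_iff hX, smul_one_eq_fromBlocks, smul_one_eq_fromBlocks]
    rw [spectrum_subset_Icc_iff hA] at hAI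
    rw [spectrum_subset_Icc_iff hB] at hBI
    exact ⟨fromBlocks_diagonal_mono hAI.1 hBI.1, fromBlocks_diagonal_mono hAI.2 hBI.2⟩
  have := h.cfc_conjTranspose_mul_mul_same_le hab hf hX hXI hV
  rwa [cfc_fromBlocks_diagonal hA hB, hcomp, hcomp] at this

end Order

end Matrix

lemma OperatorMonotoneOn.mono {f : ℝ → ℝ} {I J : Set ℝ} (h : OperatorMonotoneOn f I)
    (hJ : J ⊆ I) : OperatorMonotoneOn f J :=
  fun n hn A B hA hB hAJ hBJ => h n hn A B hA hB (fun i => hJ (hAJ i)) fun i => hJ (hBJ i)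

lemma OperatorConvexOn.mono {f : ℝ → ℝ} {I J : Set ℝ} (h : OperatorConvexOn f I)
    (hJ : J ⊆ I) : OperatorConvexOn f J :=
  fun n hn t ht A B hA hB hAB hAJ hBJ =>
    h n hn t ht A B hA hB hAB (fun i => hJ (hAJ i)) fun i => hJ (hBJ i)

lemma Set.Finite.exists_subset_Icc {I s : Set ℝ} (hnt : I.Nontrivial) {a : ℝ}
    (hleft : ∀ x ∈ I, a ≤ x) (hs : s.Finite) (hsI : s ⊆ I) :
    ∃ b ∈ I, a < b ∧ s ⊆ Set.Icc a b := by
  obtain ⟨c, hc, hca⟩ := hnt.exists_ne a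
  obtain ⟨b, hb, hmax⟩ := Set.exists_max_image (insert c s) id (hs.insert c) ⟨c, mem_insert c s⟩
  refine ⟨b, insert_subset hc hsI hb, ?_, fun x hx => ⟨hleft x (hsI hx), hmax x (.inr hx)⟩⟩
  exact ((hleft c hc).lt_of_ne hca.symm).trans_le (hmax c (mem_insert c s))

/-- for a nondegenerate interval `I` containing its left endpoint `a` and a
continuous `f : I → ℝ`, `f` is operator convex on `I` iff `g(x) = (f(x) − f(a))/(x − a)` is
operator monotone on `I \ {a}`. -/
theorem stmt16 (I : Set ℝ) (hI : Convex ℝ I) (hnt : I.Nontrivial)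
    (a : ℝ) (ha : a ∈ I) (hleft : ∀ x ∈ I, a ≤ x)
    (f : ℝ → ℝ) (hf : ContinuousOn f I) :
    OperatorConvexOn f I ↔
      OperatorMonotoneOn (fun x => (f x - f a) / (x - a)) (I \ {a}) := by
  have hsub : ∀ {n : ℕ} {A B : Matrix (Fin n) (Fin n) ℂ} (hA : A.IsHermitian)
      (hB : B.IsHermitian), (∀ i, hA.eigenvalues i ∈ I) → (∀ i, hB.eigenvalues i ∈ I) →
      ∃ b, a < b ∧ Icc a b ⊆ I ∧ spectrum ℝ A ⊆ Icc a b ∧ spectrum ℝ B ⊆ Icc a b := by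
    intro n A B hA hB hAI hBI
    obtain ⟨b, hb, hab, hs⟩ := (A.finite_real_spectrum.union
      B.finite_real_spectrum).exists_subset_Icc hnt hleft (union_subset
        (hA.spectrum_real_eq_range_eigenvalues ▸ range_subset_iff.2 hAI)
        (hB.spectrum_real_eq_range_eigenvalues ▸ range_subset_iff.2 hBI))
    exact ⟨b, hab, hI.ordConnected.out ha hb, subset_union_left.trans hs,
      subset_union_right.trans hs⟩
  constructor
  · intro h n hn A B hA hB hAI hBI hAB
    obtain ⟨b, -, hbI, hAs, hBs⟩ := hsub hA hB (fun i => (hAI i).1) fun i => (hBI i).1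
    have hne : ∀ {M : Matrix (Fin n) (Fin n) ℂ} (hM : M.IsHermitian),
        (∀ i, hM.eigenvalues i ∈ I \ {a}) → spectrum ℝ M ⊆ Icc a b → spectrum ℝ M ⊆ Ioc a b := by
      intro M hM hMI hMs x hx
      refine ⟨(hMs hx).1.lt_of_ne ?_, (hMs hx).2⟩
      rw [hM.spectrum_real_eq_range_eigenvalues] at hx
      obtain ⟨i, rfl⟩ := hx
      exact Ne.symm (hMI i).2
    rw [← hA.cfc_eq, ← hB.cfc_eq]
    exact (h.mono hbI).cfc_slope_le hA hB (hne hA hAI hAs) (hne hB hBI hBs) hAB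
  · intro h n hn t ht A B hA hB hAB hAI hBI
    obtain ⟨b, hab, hbI, hAs, hBs⟩ := hsub hA hB hAI hBI
    rw [← hA.cfc_eq, ← hB.cfc_eq, ← hAB.cfc_eq]
    have := (h.mono fun x hx => ⟨hbI (Ioc_subset_Icc_self hx), hx.1.ne'⟩ :
      OperatorMonotoneOn _ (Ioc a b)).cfc_convex_combination_le hab (hf.mono hbI) hA hB hAs hBs ht
    have hsmul : ∀ P Q : Matrix (Fin n) (Fin n) ℂ,
        (t : ℂ) • P + ((1 : ℂ) - (t : ℂ)) • Q = t • P + (1 - t) • Q := by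
      intro P Q
      rw [← Complex.ofReal_one, ← Complex.ofReal_sub, Complex.coe_smul, Complex.coe_smul]
    rw [hsmul, hsmul]
    exact this
end

section
/- Let I ⊆ ℝ be a nondegenerate interval. If r ∈ ℝ satisfies r > x for all x ∈ I, then the function x ↦ 1/(r − x) is strongly operator convex on I; likewise, if r ∈ ℝ satisfies r < x for all x ∈ I, then the function x ↦ 1/(x − r) is strongly operator convex on I. -/
open Matrix Set
open scoped ComplexOrder

section

variable {m : Type*} [Fintype m] [DecidableEq m]

/-- The functional calculus of an affine function. -/
lemma cfc_affine_matrix {A : Matrix m m ℂ} (hA : A.IsHermitian) (a b : ℝ) :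
    cfc (fun x : ℝ => a * x + b) A = a • A + b • (1 : Matrix m m ℂ) := by
  have hA' : IsSelfAdjoint A := hA
  rw [cfc_add_const b (fun x => a * x) A, cfc_const_mul_id a A, Algebra.algebraMap_eq_smul_one]

/-- On matrices every function is continuous on the (finite) spectrum. -/
lemma continuousOn_spectrum_matrix {A : Matrix m m ℂ} (hA : A.IsHermitian) (f : ℝ → ℝ) :
    ContinuousOn f (spectrum ℝ A) := by
  rw [hA.spectrum_real_eq_range_eigenvalues]
  exact (Set.finite_range _).continuousOn f

/-- Compression inequality for the inverse of a positive affine function. -/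
lemma posSemidef_cfc_inv_affine_sub_compression {P H K : Matrix m m ℂ} (hP : P.IsHermitian)
    (hPP : P * P = P) (hH : H.IsHermitian) (hK : K.IsHermitian) {a b : ℝ}
    (hPK : P * K = P * H * P) (hKP : K * P = P * H * P)
    (hpos : ∀ i, 0 < a * hH.eigenvalues i + b) :
    (hH.cfc (fun x => (a * x + b)⁻¹) - P * hK.cfc (fun x => (a * x + b)⁻¹) * P).PosSemidef := by
  have hspec : ∀ x ∈ spectrum ℝ H, 0 < a * x + b := by
    rw [hH.spectrum_real_eq_range_eigenvalues]
    rintro _ ⟨i, rfl⟩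
    exact hpos i
  rw [← hH.cfc_eq, ← hK.cfc_eq]
  set g : ℝ → ℝ := fun x => a * x + b with hg
  set f : ℝ → ℝ := fun x => (a * x + b)⁻¹ with hf
  have cH := continuousOn_spectrum_matrix hH
  have cK := continuousOn_spectrum_matrix hK
  have hFM : cfc f H * cfc g H = 1 := by
    rw [← cfc_mul f g H (cH f) (cH g), ← cfc_one ℝ H hH]
    exact cfc_congr fun x hx => inv_mul_cancel₀ (hspec x hx).ne'
  have hMF : cfc g H * cfc f H = 1 := by rw [cfc_commute_cfc g f H |>.eq, hFM]
  have hGNG : cfc f K * cfc g K * cfc f K = cfc f K := by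
    rw [← cfc_mul f g K (cK f) (cK g), ← cfc_mul _ f K (cK _) (cK f)]
    exact cfc_congr fun x _ => by simpa using mul_inv_mul_cancel (g x)⁻¹
  have hGP : Commute (cfc f K) P :=
    Commute.cfc_real (show Commute K P from hKP.trans hPK.symm) f
  have hPMP : P * cfc g H * P = P * cfc g K := by
    rw [hg, cfc_affine_matrix hH, cfc_affine_matrix hK]
    simp only [mul_add, add_mul, mul_smul_comm, smul_mul_assoc, mul_one, hPP, hPK]
  have hQ : P * cfc f K * P = P * cfc f K := by rw [mul_assoc, hGP.eq, ← mul_assoc, hPP]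
  have hQ' : P * cfc f K = cfc f K * P := hGP.eq.symm
  have hMpos : (cfc g H).PosSemidef := by
    rw [hH.cfc_eq, IsHermitian.cfc, Unitary.conjStarAlgAut_apply]
    refine (PosSemidef.diagonal fun i => ?_).mul_mul_conjTranspose_same _
    exact RCLike.ofReal_nonneg.mpr (hpos i).le
  have hQMQ : P * cfc f K * cfc g H * (P * cfc f K) = P * cfc f K := by
    calc P * cfc f K * cfc g H * (P * cfc f K)
        = cfc f K * (P * cfc g H * P) * cfc f K := by rw [hQ']; simp only [mul_assoc, hQ']
      _ = P * (cfc f K * cfc g K * cfc f K) := by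
        rw [hPMP, ← mul_assoc (cfc f K), ← hQ']; simp only [mul_assoc]
      _ = P * cfc f K := by rw [hGNG]
  have hD : (cfc f H - P * cfc f K).IsHermitian := by
    have h1 : (cfc f H).IsHermitian := cfc_predicate f H
    have h2 : (cfc f K).IsHermitian := cfc_predicate f K
    refine h1.sub ?_
    rw [IsHermitian, conjTranspose_mul, h2.eq, hP.eq, hQ']
  have key : (cfc f H - P * cfc f K) * cfc g H * (cfc f H - P * cfc f K)ᴴ
      = cfc f H - P * cfc f K := by
    rw [hD.eq, sub_mul, hFM, mul_sub, sub_mul, sub_mul, hQMQ, mul_assoc _ (cfc g H), hMF]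
    simp
  rw [hQ, ← key]
  exact hMpos.mul_mul_conjTranspose_same _

end

/-- The inverse of an affine function that is positive on `I` is strongly operator convex. -/
lemma stronglyOperatorConvexOn_inv_affine {I : Set ℝ} (hI : I.Nonempty) {a b : ℝ}
    (hpos : ∀ x ∈ I, 0 < a * x + b) :
    StronglyOperatorConvexOn (fun x => (a * x + b)⁻¹) I := by
  obtain ⟨x₀, hx₀⟩ := hI
  refine ⟨x₀, hx₀, fun n _ P H hP hPP hH hK hev => ?_⟩
  refine posSemidef_cfc_inv_affine_sub_compression hP hPP hH hK ?_ ?_ fun i => hpos _ (hev i)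
  · rw [mul_add, mul_smul_comm, mul_sub, mul_one, hPP, sub_self, smul_zero, add_zero,
      ← mul_assoc, ← mul_assoc, hPP]
  · rw [add_mul, smul_mul_assoc, sub_mul, one_mul, hPP, sub_self, smul_zero, add_zero,
      mul_assoc, hPP]

/-- if `r > x` for all `x ∈ I`, then `x ↦ 1/(r − x)` is strongly operator convex
on `I`; if `r < x` for all `x ∈ I`, then `x ↦ 1/(x − r)` is strongly operator convex on `I`. -/
theorem stmt17 (I : Set ℝ) (hI : Convex ℝ I) (hnt : I.Nontrivial) (r : ℝ) :
    ((∀ x ∈ I, x < r) → StronglyOperatorConvexOn (fun x => 1 / (r - x)) I) ∧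
    ((∀ x ∈ I, r < x) → StronglyOperatorConvexOn (fun x => 1 / (x - r)) I) := by
  constructor <;> intro h
  · convert stronglyOperatorConvexOn_inv_affine hnt.nonempty (a := -1) (b := r)
      (fun x hx => by linarith [h x hx]) using 2 with x
    rw [one_div, neg_one_mul, neg_add_eq_sub]
  · convert stronglyOperatorConvexOn_inv_affine hnt.nonempty (a := 1) (b := -r)
      (fun x hx => by linarith [h x hx]) using 2 with x
    rw [one_div, one_mul, ← sub_eq_add_neg]
end

section
/- Let I ⊆ ℝ be a nondegenerate interval, let f be operator monotone on I, and let x₀ ∈ I. Then the function g defined on I by g(x) = (x − x₀)·f(x) is operator convex on I. -/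
open Matrix Set
open scoped ComplexOrder

open Polynomial in
/-- Rectangular intertwining relations pass to polynomials. -/
theorem aeval_mul_eq_mul_aeval_of_intertwine {m n : Type*} [Fintype m] [Fintype n]
    [DecidableEq m] [DecidableEq n] {X : Matrix m m ℂ} {Y : Matrix n n ℂ} {C : Matrix m n ℂ}
    (h : X * C = C * Y) (q : ℝ[X]) : aeval X q * C = C * aeval Y q := by
  induction q using Polynomial.induction_on' with
  | add p q hp hq => rw [map_add, map_add, Matrix.add_mul, Matrix.mul_add, hp, hq]
  | monomial k r =>
    have hk : X ^ k * C = C * Y ^ k := by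
      induction k with
      | zero => simp
      | succ k ih =>
        rw [pow_succ, pow_succ', Matrix.mul_assoc, h, ← Matrix.mul_assoc, ih, Matrix.mul_assoc,
          ← pow_succ, ← pow_succ']
    rw [aeval_monomial, aeval_monomial, Algebra.algebraMap_eq_smul_one,
      Algebra.algebraMap_eq_smul_one, smul_mul_assoc, smul_mul_assoc, one_mul, one_mul,
      Matrix.smul_mul, Matrix.mul_smul, hk]

theorem Matrix.continuousOn_real_spectrum_s19 {n : Type*} [Fintype n] [DecidableEq n]
    (f : ℝ → ℝ) (X : Matrix n n ℂ) : ContinuousOn f (spectrum ℝ X) :=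
  (Matrix.finite_real_spectrum (A := X)).continuousOn f

open Polynomial in
/-- Rectangular intertwining relations pass to the functional calculus. -/
theorem cfc_mul_eq_mul_cfc_of_intertwine {m n : Type*} [Fintype m] [Fintype n]
    [DecidableEq m] [DecidableEq n] {X : Matrix m m ℂ} {Y : Matrix n n ℂ} {C : Matrix m n ℂ}
    (hX : X.IsHermitian) (hY : Y.IsHermitian) (h : X * C = C * Y) (f : ℝ → ℝ) :
    cfc f X * C = C * cfc f Y := by
  have hfin : (spectrum ℝ X ∪ spectrum ℝ Y).Finite :=
    Matrix.finite_real_spectrum.union Matrix.finite_real_spectrum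
  set q : ℝ[X] := Lagrange.interpolate hfin.toFinset id f
  have hq : ∀ z ∈ spectrum ℝ X ∪ spectrum ℝ Y, f z = q.eval z := fun z hz =>
    (Lagrange.eval_interpolate_at_node (v := id) f (Set.injOn_id _)
      (hfin.mem_toFinset.2 hz)).symm
  rw [cfc_congr (g := q.eval) fun z hz => hq z (Or.inl hz),
    cfc_congr (a := Y) (g := q.eval) fun z hz => hq z (Or.inr hz),
    cfc_polynomial q X hX.isSelfAdjoint, cfc_polynomial q Y hY.isSelfAdjoint]
  exact aeval_mul_eq_mul_aeval_of_intertwine h q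

open scoped MatrixOrder in
theorem Matrix.IsHermitian.spectrum_subset_Icc_iff {n : Type*} [Fintype n] [DecidableEq n]
    {X : Matrix n n ℂ} (hX : X.IsHermitian) (a b : ℝ) :
    spectrum ℝ X ⊆ Set.Icc a b ↔
      (X - a • (1 : Matrix n n ℂ)).PosSemidef ∧ (b • (1 : Matrix n n ℂ) - X).PosSemidef := by
  rw [← Matrix.le_iff, ← Matrix.le_iff, ← Algebra.algebraMap_eq_smul_one,
    ← Algebra.algebraMap_eq_smul_one,
    algebraMap_le_iff_le_spectrum (a := X) (ha := hX.isSelfAdjoint),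
    le_algebraMap_iff_spectrum_le (a := X) (ha := hX.isSelfAdjoint)]
  exact ⟨fun h => ⟨fun z hz => (h hz).1, fun z hz => (h hz).2⟩,
    fun h z hz => ⟨h.1 z hz, h.2 z hz⟩⟩

open scoped MatrixOrder in
theorem Matrix.PosSemidef.exists_isHermitian_mul_self {n : Type*} [Fintype n] [DecidableEq n]
    {X : Matrix n n ℂ} (hX : X.PosSemidef) : ∃ x : Matrix n n ℂ, x.IsHermitian ∧ x * x = X := by
  have h0 : 0 ≤ X := hX.nonneg
  have hs : ∀ z ∈ spectrum ℝ X, 0 ≤ z := fun z hz => spectrum_nonneg_of_nonneg h0 hz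
  refine ⟨cfc Real.sqrt X, cfc_predicate Real.sqrt X, ?_⟩
  rw [← cfc_mul Real.sqrt Real.sqrt X (Matrix.continuousOn_real_spectrum_s19 _ _)
    (Matrix.continuousOn_real_spectrum_s19 _ _)]
  conv_rhs => rw [← cfc_id ℝ X hX.1.isSelfAdjoint]
  exact cfc_congr fun z hz => Real.mul_self_sqrt (hs z hz)

theorem Matrix.PosSemidef.real_smul {n : Type*} {X : Matrix n n ℂ} (hX : X.PosSemidef)
    {r : ℝ} (hr : 0 ≤ r) : (r • X).PosSemidef := hX.smul hr

theorem cfc_sub_const_mul {n : Type*} [Fintype n] [DecidableEq n] {X : Matrix n n ℂ}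
    (hX : X.IsHermitian) (f : ℝ → ℝ) (c : ℝ) :
    cfc (fun x => (x - c) * f x) X = (X - c • (1 : Matrix n n ℂ)) * cfc f X := by
  have hX' : IsSelfAdjoint X := hX.isSelfAdjoint
  rw [cfc_mul (fun x => x - c) f X (Matrix.continuousOn_real_spectrum_s19 _ _)
    (Matrix.continuousOn_real_spectrum_s19 _ _), cfc_sub (fun x => x) (fun _ => c) X,
    cfc_id' ℝ X, cfc_const c X, Algebra.algebraMap_eq_smul_one]

/-- Two isometries with complementary orthogonal ranges. -/
theorem exists_complementary_isometries (n : ℕ) :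
    ∃ J L : Matrix (Fin (n + n)) (Fin n) ℂ, Jᴴ * J = 1 ∧ Lᴴ * L = 1 ∧ Jᴴ * L = 0 ∧ Lᴴ * J = 0 ∧
      J * Jᴴ + L * Lᴴ = 1 := by
  let e : Fin (n + n) ≃ Fin n ⊕ Fin n := finSumFinEquiv.symm
  refine ⟨(Matrix.fromRows 1 0).submatrix e id, (Matrix.fromRows 0 1).submatrix e id,
    ?_, ?_, ?_, ?_, ?_⟩
  all_goals
    simp only [Matrix.conjTranspose_submatrix, Matrix.submatrix_mul_equiv,
      Matrix.conjTranspose_fromRows_eq_fromCols_conjTranspose, Matrix.fromCols_mul_fromRows,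
      Matrix.submatrix_id_id, Matrix.conjTranspose_one, Matrix.conjTranspose_zero, mul_one,
      mul_zero, add_zero, zero_add]
  rw [← Matrix.submatrix_mul _ _ e id e Function.bijective_id,
    ← Matrix.submatrix_mul _ _ e id e Function.bijective_id]
  rw [Matrix.fromRows_mul_fromCols, Matrix.fromRows_mul_fromCols]
  refine (congrArg (fun X => Matrix.submatrix X e e)
    (Matrix.fromBlocks_add (α := ℂ) _ _ _ _ _ _ _ _)).trans ?_
  simp

/-- The operator inequality behind the theorem: `s = 1` treats a left endpoint `p`, and `s = -1`
a right endpoint. -/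
theorem OperatorMonotoneOn.posSemidef_convex_combination {f : ℝ → ℝ} {a b s p : ℝ}
    (hf : OperatorMonotoneOn f (Set.Icc a b)) (hs : s = 1 ∧ p = a ∨ s = -1 ∧ p = b)
    {n : ℕ} (hn : 0 < n) {t : ℝ} (ht : t ∈ Set.Icc (0 : ℝ) 1) {A B : Matrix (Fin n) (Fin n) ℂ}
    (hA : A.IsHermitian) (hB : B.IsHermitian)
    (hAI : spectrum ℝ A ⊆ Set.Icc a b) (hBI : spectrum ℝ B ⊆ Set.Icc a b) :
    (t • ((A - p • (1 : Matrix (Fin n) (Fin n) ℂ)) * cfc f A) +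
      (1 - t) • ((B - p • (1 : Matrix (Fin n) (Fin n) ℂ)) * cfc f B) -
      (t • A + (1 - t) • B - p • (1 : Matrix (Fin n) (Fin n) ℂ)) *
        cfc f (t • A + (1 - t) • B)).PosSemidef := by
  obtain ⟨J, L, hJJ, hLL, hJL, hLJ, hsum⟩ := exists_complementary_isometries n
  have hroot : ∀ X : Matrix (Fin n) (Fin n) ℂ, X.IsHermitian → spectrum ℝ X ⊆ Set.Icc a b →
      ∃ x : Matrix (Fin n) (Fin n) ℂ, x.IsHermitian ∧
        X = p • (1 : Matrix (Fin n) (Fin n) ℂ) + s • (x * x) := by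
    intro X hX hXI
    have h := (hX.spectrum_subset_Icc_iff a b).1 hXI
    rcases hs with ⟨rfl, rfl⟩ | ⟨rfl, rfl⟩
    · obtain ⟨x, hx, hxx⟩ := h.1.exists_isHermitian_mul_self
      exact ⟨x, hx, by rw [hxx]; module⟩
    · obtain ⟨x, hx, hxx⟩ := h.2.exists_isHermitian_mul_self
      exact ⟨x, hx, by rw [hxx]; module⟩
  obtain ⟨x, hx, hAx⟩ := hroot A hA hAI
  obtain ⟨y, hy, hBy⟩ := hroot B hB hBI
  obtain ⟨u, hu⟩ : ∃ u : ℝ, u * u = t := ⟨√t, Real.mul_self_sqrt ht.1⟩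
  obtain ⟨v, hv⟩ : ∃ v : ℝ, v * v = 1 - t := ⟨√(1 - t), Real.mul_self_sqrt (sub_nonneg.2 ht.2)⟩
  set M := t • A + (1 - t) • B with hM
  set V := u • (J * x) + v • (L * y) with hV
  set Y := v • (J * x) - u • (L * y) with hY
  have hVH : Vᴴ = u • (x * Jᴴ) + v • (y * Lᴴ) := by
    simp [hV, Matrix.conjTranspose_smul, Matrix.conjTranspose_mul, hx.eq, hy.eq]
  have hYH : Yᴴ = v • (x * Jᴴ) - u • (y * Lᴴ) := by
    simp [hY, Matrix.conjTranspose_smul, Matrix.conjTranspose_mul, hx.eq, hy.eq]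
  set N := J * A * Jᴴ + L * B * Lᴴ with hN
  set K := p • (1 : Matrix (Fin (n + n)) (Fin (n + n)) ℂ) + s • (V * Vᴴ) with hK
  have hMherm : M.IsHermitian := by
    simp [Matrix.IsHermitian, hM, Matrix.conjTranspose_smul, hA.eq, hB.eq]
  have hNherm : N.IsHermitian := by
    simp [Matrix.IsHermitian, hN, Matrix.conjTranspose_mul, Matrix.mul_assoc, hA.eq, hB.eq]
  have hKherm : K.IsHermitian := by
    simp [Matrix.IsHermitian, hK, Matrix.conjTranspose_smul, Matrix.conjTranspose_mul]
  have hshift : ∀ r : ℝ, r • (1 : Matrix (Fin (n + n)) (Fin (n + n)) ℂ) =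
      J * (r • (1 : Matrix (Fin n) (Fin n) ℂ)) * Jᴴ +
        L * (r • (1 : Matrix (Fin n) (Fin n) ℂ)) * Lᴴ := by
    intro r
    simp only [Matrix.mul_smul, Matrix.smul_mul, Matrix.mul_one, ← smul_add, hsum]
  have hVV : M - p • (1 : Matrix (Fin n) (Fin n) ℂ) = s • (Vᴴ * V) := by
    have h1 : Vᴴ * V = t • (x * x) + (1 - t) • (y * y) := by
      rw [hVH, hV]
      simp only [Matrix.add_mul, Matrix.mul_add, Matrix.smul_mul, Matrix.mul_smul,
        Matrix.mul_assoc]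
      simp only [← Matrix.mul_assoc Jᴴ, ← Matrix.mul_assoc Lᴴ, hJJ, hLL, hJL, hLJ, Matrix.one_mul,
        Matrix.zero_mul, Matrix.mul_zero, smul_zero, add_zero, zero_add]
      rw [← hv, ← hu]
      module
    rw [h1, hM, hAx, hBy]
    module
  have hNK : N - K = s • (Y * Yᴴ) := by
    have h1 : V * Vᴴ + Y * Yᴴ = J * (x * x) * Jᴴ + L * (y * y) * Lᴴ := by
      have huv : u * u + v * v = 1 := by rw [hu, hv]; ring
      rw [hVH, hV, hYH, hY]
      simp only [Matrix.add_mul, Matrix.mul_add, Matrix.sub_mul, Matrix.mul_sub, Matrix.smul_mul,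
        Matrix.mul_smul, Matrix.mul_assoc]
      conv_rhs =>
        rw [← one_smul ℝ (J * (x * (x * Jᴴ))), ← one_smul ℝ (L * (y * (y * Lᴴ))), ← huv]
      module
    have h2 : N = p • 1 + s • (V * Vᴴ + Y * Yᴴ) := by
      rw [h1, hN, hAx, hBy, hshift p]
      simp only [Matrix.add_mul, Matrix.mul_add, Matrix.smul_mul, Matrix.mul_smul]
      module
    rw [h2, hK]
    module
  have hconj : ∀ X Z : Matrix (Fin n) (Fin n) ℂ, X.PosSemidef → Z.PosSemidef →
      (J * X * Jᴴ + L * Z * Lᴴ).PosSemidef := fun X Z hX hZ =>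
    (hX.mul_mul_conjTranspose_same J).add (hZ.mul_mul_conjTranspose_same L)
  have hA' := (hA.spectrum_subset_Icc_iff a b).1 hAI
  have hB' := (hB.spectrum_subset_Icc_iff a b).1 hBI
  have hNa : (N - a • (1 : Matrix (Fin (n + n)) (Fin (n + n)) ℂ)).PosSemidef := by
    convert hconj _ _ hA'.1 hB'.1 using 1
    rw [hshift a, hN, Matrix.mul_sub, Matrix.mul_sub, Matrix.sub_mul, Matrix.sub_mul]
    abel
  have hNb : (b • (1 : Matrix (Fin (n + n)) (Fin (n + n)) ℂ) - N).PosSemidef := by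
    convert hconj _ _ hA'.2 hB'.2 using 1
    rw [hshift b, hN, Matrix.mul_sub, Matrix.mul_sub, Matrix.sub_mul, Matrix.sub_mul]
    abel
  have hNI : spectrum ℝ N ⊆ Set.Icc a b := (hNherm.spectrum_subset_Icc_iff a b).2 ⟨hNa, hNb⟩
  have hYY : (Y * Yᴴ).PosSemidef := Matrix.posSemidef_self_mul_conjTranspose Y
  have hVVp : (V * Vᴴ).PosSemidef := Matrix.posSemidef_self_mul_conjTranspose V
  have hmono : ∀ {X Z : Matrix (Fin (n + n)) (Fin (n + n)) ℂ}, X.IsHermitian → Z.IsHermitian →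
      spectrum ℝ X ⊆ Set.Icc a b → spectrum ℝ Z ⊆ Set.Icc a b → (Z - X).PosSemidef →
      (cfc f Z - cfc f X).PosSemidef := by
    intro X Z hX hZ hXI hZI hXZ
    rw [hX.cfc_eq, hZ.cfc_eq]
    exact hf (n + n) (by omega) X Z hX hZ (fun i => hXI (hX.eigenvalues_mem_spectrum_real i))
      (fun i => hZI (hZ.eigenvalues_mem_spectrum_real i)) hXZ
  have hmain : (s • (cfc f N - cfc f K)).PosSemidef := by
    rcases hs with ⟨rfl, rfl⟩ | ⟨rfl, rfl⟩
    · have hKN : (N - K).PosSemidef := by rw [hNK, one_smul]; exact hYY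
      have hKI : spectrum ℝ K ⊆ Set.Icc p b := by
        refine (hKherm.spectrum_subset_Icc_iff p b).2 ⟨?_, ?_⟩
        · convert hVVp using 1
          rw [hK]; module
        · convert hNb.add hKN using 1
          abel
      rw [one_smul]
      exact hmono hKherm hNherm hKI hNI hKN
    · have hKN : (K - N).PosSemidef := by
        rw [← neg_sub, hNK]
        convert hYY using 1
        module
      have hKI : spectrum ℝ K ⊆ Set.Icc a p := by
        refine (hKherm.spectrum_subset_Icc_iff a p).2 ⟨?_, ?_⟩
        · convert hNa.add hKN using 1
          abel
        · convert hVVp using 1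
          rw [hK]; module
      convert hmono hNherm hKherm hNI hKI hKN using 1
      module
  have hKV : cfc f K * V = V * cfc f M := by
    refine cfc_mul_eq_mul_cfc_of_intertwine hKherm hMherm ?_ f
    clear_value V
    rw [eq_add_of_sub_eq' hVV, hK, Matrix.add_mul, Matrix.mul_add, Matrix.smul_mul,
      Matrix.smul_mul, Matrix.mul_smul, Matrix.mul_smul, Matrix.one_mul, Matrix.mul_one,
      Matrix.mul_assoc]
  have hNJ : cfc f N * J = J * cfc f A := by
    refine cfc_mul_eq_mul_cfc_of_intertwine hNherm hA ?_ f
    simp only [hN, Matrix.add_mul, Matrix.mul_assoc, hJJ, hLJ, Matrix.mul_one, Matrix.mul_zero,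
      add_zero]
  have hNL : cfc f N * L = L * cfc f B := by
    refine cfc_mul_eq_mul_cfc_of_intertwine hNherm hB ?_ f
    simp only [hN, Matrix.add_mul, Matrix.mul_assoc, hLL, hJL, Matrix.mul_one, Matrix.mul_zero,
      zero_add]
  have hAcomm : cfc f A * x = x * cfc f A := by
    refine cfc_mul_eq_mul_cfc_of_intertwine hA hA ?_ f
    rw [hAx]
    simp only [Matrix.add_mul, Matrix.mul_add, Matrix.smul_mul, Matrix.mul_smul, Matrix.one_mul,
      Matrix.mul_one, Matrix.mul_assoc]
  have hBcomm : cfc f B * y = y * cfc f B := by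
    refine cfc_mul_eq_mul_cfc_of_intertwine hB hB ?_ f
    rw [hBy]
    simp only [Matrix.add_mul, Matrix.mul_add, Matrix.smul_mul, Matrix.mul_smul, Matrix.one_mul,
      Matrix.mul_one, Matrix.mul_assoc]
  have hNV : Vᴴ * (cfc f N * V) = t • (x * x * cfc f A) + (1 - t) • (y * y * cfc f B) := by
    have h1 : cfc f N * V = u • (J * (x * cfc f A)) + v • (L * (y * cfc f B)) := by
      rw [hV, Matrix.mul_add, Matrix.mul_smul, Matrix.mul_smul, ← Matrix.mul_assoc,
        ← Matrix.mul_assoc, hNJ, hNL, Matrix.mul_assoc, Matrix.mul_assoc, hAcomm, hBcomm]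
    rw [h1, hVH]
    simp only [Matrix.add_mul, Matrix.mul_add, Matrix.smul_mul, Matrix.mul_smul,
      Matrix.mul_assoc]
    simp only [← Matrix.mul_assoc Jᴴ, ← Matrix.mul_assoc Lᴴ, hJJ, hLL, hJL, hLJ, Matrix.one_mul,
      Matrix.zero_mul, Matrix.mul_zero, smul_zero, add_zero, zero_add]
    rw [← hv, ← hu]
    module
  convert hmain.conjTranspose_mul_mul_same V using 1
  have hAp : A - p • (1 : Matrix (Fin n) (Fin n) ℂ) = s • (x * x) := by rw [hAx]; abel
  have hBp : B - p • (1 : Matrix (Fin n) (Fin n) ℂ) = s • (y * y) := by rw [hBy]; abel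
  clear_value V
  rw [hVV, hAp, hBp, Matrix.mul_assoc, Matrix.smul_mul _ (cfc f N - cfc f K) V, Matrix.sub_mul,
    Matrix.mul_smul, Matrix.mul_sub, hNV, hKV]
  simp only [Matrix.smul_mul, Matrix.mul_assoc]
  module

/-- if `f` is operator monotone on a nondegenerate interval `I` and `x₀ ∈ I`,
then `g(x) = (x − x₀)·f(x)` is operator convex on `I`. -/
theorem stmt19 (I : Set ℝ) (hI : Convex ℝ I) (hnt : I.Nontrivial)
    (f : ℝ → ℝ) (hf : OperatorMonotoneOn f I) (x₀ : ℝ) (hx₀ : x₀ ∈ I) :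
    OperatorConvexOn (fun x => (x - x₀) * f x) I := by
  intro n hn t ht A B hA hB hAB hAI hBI
  obtain ⟨a, b, ha, hb, hx, hAab, hBab⟩ : ∃ a b : ℝ, a ∈ I ∧ b ∈ I ∧ x₀ ∈ Set.Icc a b ∧
      (∀ i, hA.eigenvalues i ∈ Set.Icc a b) ∧ ∀ i, hB.eigenvalues i ∈ Set.Icc a b := by
    let S : Finset ℝ := insert x₀ (Finset.univ.image hA.eigenvalues ∪
      Finset.univ.image hB.eigenvalues)
    have hS : S.Nonempty := ⟨x₀, Finset.mem_insert_self _ _⟩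
    have hSI : ∀ z ∈ S, z ∈ I := by
      intro z hz
      simp only [S, Finset.mem_insert, Finset.mem_union, Finset.mem_image, Finset.mem_univ,
        true_and] at hz
      rcases hz with rfl | ⟨i, rfl⟩ | ⟨i, rfl⟩
      exacts [hx₀, hAI i, hBI i]
    have hSab : ∀ z ∈ S, z ∈ Set.Icc (S.min' hS) (S.max' hS) := fun z hz =>
      ⟨S.min'_le z hz, S.le_max' z hz⟩
    exact ⟨S.min' hS, S.max' hS, hSI _ (S.min'_mem hS), hSI _ (S.max'_mem hS),
      hSab _ (by simp [S]), fun i => hSab _ (by simp [S]), fun i => hSab _ (by simp [S])⟩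
  have hsub : Set.Icc a b ⊆ I := hI.ordConnected.out ha hb
  have hf' : OperatorMonotoneOn f (Set.Icc a b) := fun m hm X Z hX hZ hXI hZI =>
    hf m hm X Z hX hZ (fun i => hsub (hXI i)) (fun i => hsub (hZI i))
  have hAs : spectrum ℝ A ⊆ Set.Icc a b := by
    rw [hA.spectrum_real_eq_range_eigenvalues]; exact Set.range_subset_iff.2 hAab
  have hBs : spectrum ℝ B ⊆ Set.Icc a b := by
    rw [hB.spectrum_real_eq_range_eigenvalues]; exact Set.range_subset_iff.2 hBab
  obtain ⟨c, d, hc, hd, hcd, hxcd⟩ : ∃ c d : ℝ, 0 ≤ c ∧ 0 ≤ d ∧ c + d = 1 ∧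
      c • a + d • b = x₀ := by
    rwa [← segment_eq_Icc (hx.1.trans hx.2)] at hx
  have hleft := (hf'.posSemidef_convex_combination (Or.inl ⟨rfl, rfl⟩) hn ht hA hB hAs
    hBs).real_smul hc
  have hright := (hf'.posSemidef_convex_combination (Or.inr ⟨rfl, rfl⟩) hn ht hA hB hAs
    hBs).real_smul hd
  have hM : (t : ℂ) • A + ((1 : ℂ) - (t : ℂ)) • B = t • A + (1 - t) • B := by
    rw [← Complex.ofReal_one, ← Complex.ofReal_sub, Complex.coe_smul, Complex.coe_smul]
  rw [← hA.cfc_eq, ← hB.cfc_eq, ← hAB.cfc_eq, cfc_sub_const_mul hA, cfc_sub_const_mul hB,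
    cfc_sub_const_mul hAB, hM, ← Complex.ofReal_one, ← Complex.ofReal_sub, Complex.coe_smul,
    Complex.coe_smul]
  have hsplit : ∀ X : Matrix (Fin n) (Fin n) ℂ, X - x₀ • (1 : Matrix (Fin n) (Fin n) ℂ) =
      c • (X - a • (1 : Matrix (Fin n) (Fin n) ℂ)) +
        d • (X - b • (1 : Matrix (Fin n) (Fin n) ℂ)) := by
    intro X
    obtain rfl : d = 1 - c := by linarith
    rw [← hxcd, smul_eq_mul, smul_eq_mul]
    module
  convert hleft.add hright using 1
  rw [hsplit A, hsplit B, hsplit (t • A + (1 - t) • B)]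
  simp only [Matrix.add_mul _ _ (cfc f _), Matrix.smul_mul _ _ (cfc f _)]
  module
end
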